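/- arXiv:2409.13874 — 4 statements merged into one kernel-verified Lean document; each statement's English description precedes it below -/
import Mathlib

section
/- For every integer n ≥ 2, the sixth crank moment satisfies Σ_{λ ⊢ n} crank(λ)^6 = 2·Σ_{a=0}^{n-1} p(a)·(360·σ_{(1,1,1)}(n−a) + 60·(σ_{(3,1)}(n−a) + σ_{(1,3)}(n−a)) − 60·σ_{(1,1)}(n−a) + 3·σ_5(n−a) − 5·σ_3(n−a) + 3·σ_1(n−a)). -/
open Finset

/-- Divisor power sum `σ_k(n) = ∑_{d ∣ n} d^k`. -/
def sigmaPow (k n : ℕ) : ℕ := ∑ d ∈ n.divisors, d ^ k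

/-- Depth-two multiple divisor sum `σ_{(s,t)}(n)`: the sum of `m1^s · m2^t` over all
quadruples of positive integers `((m1, m2), (n1, n2))` with `m1·n1 + m2·n2 = n` and `n1 < n2`. -/
def sigmaPow2 (s t n : ℕ) : ℕ :=
  ∑ p ∈ ((Finset.Icc 1 n ×ˢ Finset.Icc 1 n) ×ˢ (Finset.Icc 1 n ×ˢ Finset.Icc 1 n)).filter
      (fun p => p.1.1 * p.2.1 + p.1.2 * p.2.2 = n ∧ p.2.1 < p.2.2),
    p.1.1 ^ s * p.1.2 ^ t

/-- Depth-three multiple divisor sum `σ_{(k1,k2,k3)}(n)`: the sum of `m1^{k1}·m2^{k2}·m3^{k3}`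
over all sextuples of positive integers `((m1, m2, m3), (n1, n2, n3))` with
`m1·n1 + m2·n2 + m3·n3 = n` and `n1 < n2 < n3`. -/
def sigmaPow3 (k1 k2 k3 n : ℕ) : ℕ :=
  ∑ p ∈ ((Finset.Icc 1 n ×ˢ Finset.Icc 1 n ×ˢ Finset.Icc 1 n) ×ˢ
      (Finset.Icc 1 n ×ˢ Finset.Icc 1 n ×ˢ Finset.Icc 1 n)).filter
      (fun p => p.1.1 * p.2.1 + p.1.2.1 * p.2.2.1 + p.1.2.2 * p.2.2.2 = n
        ∧ p.2.1 < p.2.2.1 ∧ p.2.2.1 < p.2.2.2),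
    p.1.1 ^ k1 * p.1.2.1 ^ k2 * p.1.2.2 ^ k3

/-- The number of partitions of `n` (with `p 0 = 1`). -/
def partitionCount (n : ℕ) : ℕ := Fintype.card (Nat.Partition n)

/-- The Andrews–Garvan crank of a partition: the largest part if there are no ones, and
otherwise the number of parts larger than the number of ones minus the number of ones. -/
def crank {n : ℕ} (lam : n.Partition) : ℤ :=
  if lam.parts.count 1 = 0 then (lam.parts.sup : ℤ)
  else ((lam.parts.filter (fun x => lam.parts.count 1 < x)).card : ℤ)
    - (lam.parts.count 1 : ℤ)


/-! ### Truncated geometric and power-sum series -/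

section Truncated

variable {A : Type*} [CommRing A]

/-- The truncated geometric series `∑_{m ≤ N} w^m`. -/
def truncGeom (N : ℕ) (w : A) : A := ∑ m ∈ range (N + 1), w ^ m

/-- The truncated series `∑_{1 ≤ m ≤ N} m^s w^m`. -/
def truncPowSum (N s : ℕ) (w : A) : A := ∑ m ∈ Ico 1 (N + 1), (m : A) ^ s * w ^ m

theorem one_sub_mul_truncGeom {N : ℕ} {w : A} (hw : w ^ (N + 1) = 0) :
    (1 - w) * truncGeom N w = 1 := by
  rw [truncGeom, mul_neg_geom_sum, hw, sub_zero]

theorem map_truncGeom {B : Type*} [CommRing B] (φ : A →+* B) (N : ℕ) (w : A) :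
    φ (truncGeom N w) = truncGeom N (φ w) := by
  simp [truncGeom]

theorem map_truncPowSum {B : Type*} [CommRing B] (φ : A →+* B) (N s : ℕ) (w : A) :
    φ (truncPowSum N s w) = truncPowSum N s (φ w) := by
  simp [truncPowSum]

theorem one_sub_sq_mul_truncPowSum_one {N : ℕ} {w : A} (hw : w ^ (N + 1) = 0) :
    (1 - w) ^ 2 * truncPowSum N 1 w = w := by
  have h : ∀ M : ℕ, (1 - w) ^ 2 * truncPowSum M 1 w
      = w - w ^ (M + 1) * ((M + 1) + ((M + 2) - 2 * (M + 1)) * w) := by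
    intro M
    induction M with
    | zero => simp [truncPowSum]
    | succ M ih =>
      rw [truncPowSum, sum_Ico_succ_top (by omega), mul_add, ← truncPowSum, ih]
      push_cast
      ring
  rw [h, hw, zero_mul, sub_zero]

theorem one_sub_pow_mul_truncPowSum_three {N : ℕ} {w : A} (hw : w ^ (N + 1) = 0) :
    (1 - w) ^ 4 * truncPowSum N 3 w = w + 4 * w ^ 2 + w ^ 3 := by
  have h : ∀ M : ℕ, (1 - w) ^ 4 * truncPowSum M 3 w
      = w + 4 * w ^ 2 + w ^ 3 - w ^ (M + 1) * ((M + 1 : A) ^ 3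
        + ((M + 2) ^ 3 - 4 * (M + 1) ^ 3) * w
        + ((M + 3) ^ 3 - 4 * (M + 2) ^ 3 + 6 * (M + 1) ^ 3) * w ^ 2
        + ((M + 4) ^ 3 - 4 * (M + 3) ^ 3 + 6 * (M + 2) ^ 3 - 4 * (M + 1) ^ 3) * w ^ 3) := by
    intro M
    induction M with
    | zero => simp [truncPowSum]; ring
    | succ M ih =>
      rw [truncPowSum, sum_Ico_succ_top (by omega), mul_add, ← truncPowSum, ih]
      push_cast
      ring
  rw [h, hw, zero_mul, sub_zero]

theorem one_sub_pow_mul_truncPowSum_five {N : ℕ} {w : A} (hw : w ^ (N + 1) = 0) :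
    (1 - w) ^ 6 * truncPowSum N 5 w
      = w + 26 * w ^ 2 + 66 * w ^ 3 + 26 * w ^ 4 + w ^ 5 := by
  have h : ∀ M : ℕ, (1 - w) ^ 6 * truncPowSum M 5 w
      = w + 26 * w ^ 2 + 66 * w ^ 3 + 26 * w ^ 4 + w ^ 5 - w ^ (M + 1) * ((M + 1 : A) ^ 5
        + ((M + 2) ^ 5 - 6 * (M + 1) ^ 5) * w
        + ((M + 3) ^ 5 - 6 * (M + 2) ^ 5 + 15 * (M + 1) ^ 5) * w ^ 2
        + ((M + 4) ^ 5 - 6 * (M + 3) ^ 5 + 15 * (M + 2) ^ 5 - 20 * (M + 1) ^ 5) * w ^ 3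
        + ((M + 5) ^ 5 - 6 * (M + 4) ^ 5 + 15 * (M + 3) ^ 5 - 20 * (M + 2) ^ 5
          + 15 * (M + 1) ^ 5) * w ^ 4
        + ((M + 6) ^ 5 - 6 * (M + 5) ^ 5 + 15 * (M + 4) ^ 5 - 20 * (M + 3) ^ 5
          + 15 * (M + 2) ^ 5 - 6 * (M + 1) ^ 5) * w ^ 5) := by
    intro M
    induction M with
    | zero => simp [truncPowSum]; ring
    | succ M ih =>
      rw [truncPowSum, sum_Ico_succ_top (by omega), mul_add, ← truncPowSum, ih]
      push_cast
      ring
  rw [h, hw, zero_mul, sub_zero]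

theorem six_mul_truncPowSum_one_sq {N : ℕ} {w : A} (hw : w ^ (N + 1) = 0) :
    6 * truncPowSum N 1 w ^ 2 = truncPowSum N 3 w - truncPowSum N 1 w := by
  have hu := one_sub_mul_truncGeom hw
  have h1 := one_sub_sq_mul_truncPowSum_one hw
  have h3 := one_sub_pow_mul_truncPowSum_three hw
  have hunit : IsUnit ((1 - w) ^ 4) := (IsUnit.of_mul_eq_one _ hu).pow 4
  apply hunit.mul_left_cancel
  linear_combination (6 * ((1 - w) ^ 2 * truncPowSum N 1 w + w) + (1 - w) ^ 2) * h1 - h3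

theorem mul_truncPowSum_one_cube {N : ℕ} {w : A} (hw : w ^ (N + 1) = 0) :
    120 * truncPowSum N 1 w ^ 3
      = truncPowSum N 5 w - 5 * truncPowSum N 3 w + 4 * truncPowSum N 1 w := by
  have hu := one_sub_mul_truncGeom hw
  have h1 := one_sub_sq_mul_truncPowSum_one hw
  have h3 := one_sub_pow_mul_truncPowSum_three hw
  have h5 := one_sub_pow_mul_truncPowSum_five hw
  have hunit : IsUnit ((1 - w) ^ 6) := (IsUnit.of_mul_eq_one _ hu).pow 6
  apply hunit.mul_left_cancel
  have h1c : (1 - w) ^ 6 * truncPowSum N 1 w ^ 3 = w ^ 3 := by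
    calc _ = ((1 - w) ^ 2 * truncPowSum N 1 w) ^ 3 := by ring
      _ = w ^ 3 := by rw [h1]
  linear_combination 120 * h1c - 4 * (1 - w) ^ 4 * h1 - h5 + 5 * (1 - w) ^ 2 * h3

/-! ### The `q`-binomial theorem modulo `q ^ (N + 1)` -/

/-- The coefficients `∏_{i < j} (1 - a q^i) / (1 - q^(i+1))` of the `q`-binomial series. -/
def qBinomCoeff (N : ℕ) (q a : A) (j : ℕ) : A :=
  ∏ i ∈ Ico 1 (j + 1), ((1 - a * q ^ (i - 1)) * truncGeom N (q ^ i))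

/-- The truncated `q`-binomial series. -/
def qBinomSeries (N : ℕ) (q a w : A) : A :=
  ∑ j ∈ range (N + 1), qBinomCoeff N q a j * w ^ j

theorem pow_pow_eq_zero {N : ℕ} {q : A} (hq : q ^ (N + 1) = 0) {i : ℕ} (hi : 1 ≤ i) :
    (q ^ i) ^ (N + 1) = 0 := by
  rw [← pow_mul, mul_comm, pow_mul, hq, zero_pow (by omega)]

theorem mul_pow_pow_eq_zero {N : ℕ} {q : A} (hq : q ^ (N + 1) = 0) (z : A) {i : ℕ}
    (hi : 1 ≤ i) : (z * q ^ i) ^ (N + 1) = 0 := by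
  rw [mul_pow, pow_pow_eq_zero hq hi, mul_zero]

theorem qBinomCoeff_succ {N : ℕ} {q : A} (hq : q ^ (N + 1) = 0) (a : A) (j : ℕ) :
    qBinomCoeff N q a (j + 1) * (1 - q ^ (j + 1)) = qBinomCoeff N q a j * (1 - a * q ^ j) := by
  have h := one_sub_mul_truncGeom (pow_pow_eq_zero hq (Nat.le_add_left 1 j))
  rw [qBinomCoeff, prod_Ico_succ_top (by omega), ← qBinomCoeff, Nat.add_sub_cancel]
  linear_combination qBinomCoeff N q a j * (1 - a * q ^ j) * h

theorem qBinomSeries_functional {N : ℕ} {q w : A} (hq : q ^ (N + 1) = 0) (a : A)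
    (hw : w ^ (N + 1) = 0) :
    (1 - w) * qBinomSeries N q a w = (1 - a * w) * qBinomSeries N q a (q * w) := by
  have h1 : qBinomSeries N q a w - qBinomSeries N q a (q * w)
      = ∑ j ∈ range (N + 1), qBinomCoeff N q a j * (1 - q ^ j) * w ^ j := by
    simp only [qBinomSeries, ← sum_sub_distrib]
    refine sum_congr rfl fun j _ => ?_
    rw [mul_pow]; ring
  have h2 : w * qBinomSeries N q a w - a * w * qBinomSeries N q a (q * w)
      = ∑ j ∈ range (N + 1), qBinomCoeff N q a j * (1 - a * q ^ j) * w ^ (j + 1) := by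
    simp only [qBinomSeries, mul_sum, ← sum_sub_distrib]
    refine sum_congr rfl fun j _ => ?_
    rw [mul_pow]; ring
  rw [sum_range_succ'] at h1
  rw [sum_range_succ, hw, mul_zero, add_zero] at h2
  simp only [qBinomCoeff_succ hq, pow_zero, sub_self, mul_zero, zero_mul, add_zero] at h1
  linear_combination h1 - h2

theorem qBinomSeries_mul_prod {N : ℕ} {q : A} (hq : q ^ (N + 1) = 0) (a v : A) :
    qBinomSeries N q a (v * q) * ∏ k ∈ Ico 1 (N + 1), (1 - v * q ^ k)
      = ∏ k ∈ Ico 1 (N + 1), (1 - a * (v * q ^ k)) := by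
  have h : ∀ M : ℕ, qBinomSeries N q a (v * q) * ∏ k ∈ Ico 1 (M + 1), (1 - v * q ^ k)
      = qBinomSeries N q a (v * q ^ (M + 1)) * ∏ k ∈ Ico 1 (M + 1), (1 - a * (v * q ^ k)) := by
    intro M
    induction M with
    | zero => simp
    | succ M ih =>
      have hf := qBinomSeries_functional hq a
        (mul_pow_pow_eq_zero hq v (Nat.le_add_left 1 M))
      rw [show q * (v * q ^ (M + 1)) = v * q ^ (M + 1 + 1) by ring] at hf
      rw [prod_Ico_succ_top (Nat.le_add_left 1 M) (fun k => 1 - v * q ^ k),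
        prod_Ico_succ_top (Nat.le_add_left 1 M) (fun k => 1 - a * (v * q ^ k)), ← mul_assoc, ih]
      linear_combination (∏ k ∈ Ico 1 (M + 1), (1 - a * (v * q ^ k))) * hf
  rw [h, hq, mul_zero]
  simp [qBinomSeries, sum_range_succ', qBinomCoeff]

theorem prod_truncGeom_mul_prod {N : ℕ} {q : A} (hq : q ^ (N + 1) = 0) (z : A) {a b : ℕ}
    (ha : 1 ≤ a) :
    (∏ k ∈ Ico a b, truncGeom N (z * q ^ k)) * ∏ k ∈ Ico a b, (1 - z * q ^ k) = 1 := by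
  rw [← prod_mul_distrib]
  refine prod_eq_one fun k hk => ?_
  rw [mul_comm]
  exact one_sub_mul_truncGeom (mul_pow_pow_eq_zero hq z (ha.trans (mem_Ico.1 hk).1))

/-- Andrews and Garvan's crank generating function modulo `q ^ (N + 1)`. -/
theorem crank_product {N : ℕ} (hN : 1 ≤ N) {q z y : A} (hq : q ^ (N + 1) = 0)
    (hzy : z * y = 1) :
    ∑ k ∈ Ico 2 (N + 1), z ^ k * q ^ k * ∏ i ∈ Ico 2 (k + 1), truncGeom N (q ^ i)
      + ∑ j ∈ Ico 1 (N + 1), y ^ j * q ^ j * (∏ i ∈ Ico 2 (j + 1), truncGeom N (q ^ i))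
          * ∏ i ∈ Ico (j + 1) (N + 1), truncGeom N (z * q ^ i)
      = (∏ i ∈ Ico 1 (N + 1),
          truncGeom N (z * q ^ i) * truncGeom N (y * q ^ i) * (1 - q ^ i))
        - (1 - q) - z * q := by
  set Z := ∏ i ∈ Ico 1 (N + 1), truncGeom N (z * q ^ i) with hZ
  set Y := ∏ i ∈ Ico 1 (N + 1), truncGeom N (y * q ^ i) with hY
  have hZu := prod_truncGeom_mul_prod hq z (b := N + 1) le_rfl
  have hYu := prod_truncGeom_mul_prod hq y (b := N + 1) le_rfl
  rw [← hZ] at hZu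
  rw [← hY] at hYu
  have h1 : (1 - q) * truncGeom N (q ^ 1) = 1 := by
    simpa using one_sub_mul_truncGeom (pow_pow_eq_zero hq le_rfl)
  have hsplit : ∀ j : ℕ, 1 ≤ j → (1 - q) * ∏ i ∈ Ico 1 (j + 1), truncGeom N (q ^ i)
      = ∏ i ∈ Ico 2 (j + 1), truncGeom N (q ^ i) := by
    intro j hj
    rw [prod_eq_prod_Ico_succ_bot (by omega), ← mul_assoc, h1, one_mul]
  have hseriesZ : qBinomSeries N q 0 (z * q) = Z := by
    have h := qBinomSeries_mul_prod hq 0 z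
    simp only [zero_mul, sub_zero, prod_const_one] at h
    linear_combination Z * h - qBinomSeries N q 0 (z * q) * hZu
  have hseriesY : qBinomSeries N q (z * q) (y * q)
      = Y * ∏ i ∈ Ico 2 (N + 1), (1 - q ^ i) := by
    have h := qBinomSeries_mul_prod hq (z * q) y
    have h2 : ∏ k ∈ Ico 1 (N + 1), (1 - z * q * (y * q ^ k))
        = ∏ i ∈ Ico 2 (N + 1), (1 - q ^ i) := by
      have e : ∀ k, 1 - z * q * (y * q ^ k) = 1 - q ^ (k + 1) := fun k => by
        linear_combination (-q ^ (k + 1)) * hzy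
      simp only [e]
      rw [prod_Ico_add' (fun i => 1 - q ^ i) 1 (N + 1) 1, prod_Ico_succ_top (by omega), hq]
      simp
    rw [h2] at h
    linear_combination Y * h - qBinomSeries N q (z * q) (y * q) * hYu
  have hprod : (∏ i ∈ Ico 1 (N + 1),
      truncGeom N (z * q ^ i) * truncGeom N (y * q ^ i) * (1 - q ^ i))
      = (1 - q) * Z * qBinomSeries N q (z * q) (y * q) := by
    rw [prod_mul_distrib, prod_mul_distrib, hseriesY,
      prod_eq_prod_Ico_succ_bot (f := fun i => 1 - q ^ i) (by omega), ← hZ, ← hY, pow_one]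
    ring
  have hbot : (1 - q) * Z = (1 - q) + z * q
      + ∑ k ∈ Ico 2 (N + 1), z ^ k * q ^ k * ∏ i ∈ Ico 2 (k + 1), truncGeom N (q ^ i) := by
    rw [← hseriesZ, qBinomSeries, range_eq_Ico, sum_eq_sum_Ico_succ_bot (by omega),
      sum_eq_sum_Ico_succ_bot (by omega), mul_add, mul_add, mul_sum, ← add_assoc]
    congr 1
    · simp only [qBinomCoeff, zero_mul, sub_zero, one_mul]
      simp only [zero_add, pow_zero, pow_one, mul_one, Ico_self, prod_empty,
        Nat.Ico_succ_singleton, prod_singleton]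
      rw [pow_one] at h1
      linear_combination (z * q) * h1
    · refine sum_congr rfl fun k hk => ?_
      simp only [qBinomCoeff, zero_mul, sub_zero, one_mul]
      rw [← hsplit k (by have := (mem_Ico.1 hk).1; omega), mul_pow]
      ring
  have hterm : ∀ j ∈ Ico 1 (N + 1), (1 - q) * Z * (qBinomCoeff N q (z * q) j * (y * q) ^ j)
      = y ^ j * q ^ j * (∏ i ∈ Ico 2 (j + 1), truncGeom N (q ^ i))
          * ∏ i ∈ Ico (j + 1) (N + 1), truncGeom N (z * q ^ i) := by
    intro j hj
    obtain ⟨hj1, hj2⟩ := mem_Ico.1 hj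
    have e : qBinomCoeff N q (z * q) j = (∏ i ∈ Ico 1 (j + 1), (1 - z * q ^ i))
        * ∏ i ∈ Ico 1 (j + 1), truncGeom N (q ^ i) := by
      rw [qBinomCoeff, prod_mul_distrib]
      congr 1
      refine prod_congr rfl fun i hi => ?_
      rw [mul_assoc, ← pow_succ', Nat.sub_add_cancel (mem_Ico.1 hi).1]
    have hcons : (∏ i ∈ Ico 1 (j + 1), truncGeom N (z * q ^ i))
        * ∏ i ∈ Ico (j + 1) (N + 1), truncGeom N (z * q ^ i) = Z :=
      prod_Ico_consecutive _ (by omega) (by omega)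
    have hu := prod_truncGeom_mul_prod hq z (b := j + 1) le_rfl
    rw [e, ← hsplit j hj1, ← hcons, mul_pow]
    linear_combination (1 - q) * (∏ i ∈ Ico (j + 1) (N + 1), truncGeom N (z * q ^ i))
      * (∏ i ∈ Ico 1 (j + 1), truncGeom N (q ^ i)) * y ^ j * q ^ j * hu
  have hsum : (1 - q) * Z * qBinomSeries N q (z * q) (y * q) = (1 - q) * Z
      + ∑ j ∈ Ico 1 (N + 1), y ^ j * q ^ j * (∏ i ∈ Ico 2 (j + 1), truncGeom N (q ^ i))
          * ∏ i ∈ Ico (j + 1) (N + 1), truncGeom N (z * q ^ i) := by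
    rw [qBinomSeries, range_eq_Ico, sum_eq_sum_Ico_succ_bot (by omega), mul_add, zero_add,
      mul_sum, sum_congr rfl hterm]
    simp [qBinomCoeff]
  linear_combination -hbot - hsum - hprod

end Truncated

/-! ### Ordered double and triple sums -/

section OrderedSums

variable {A : Type*} [CommRing A]

/-- The sum of `F i * G j` over `1 ≤ i < j ≤ M`. -/
def orderedSum₂ (M : ℕ) (F G : ℕ → A) : A :=
  ∑ j ∈ Ico 1 (M + 1), ∑ i ∈ Ico 1 j, F i * G j

/-- The sum of `F i * F j * F k` over `1 ≤ i < j < k ≤ M`. -/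
def orderedSum₃ (M : ℕ) (F : ℕ → A) : A :=
  ∑ k ∈ Ico 1 (M + 1), ∑ j ∈ Ico 1 k, ∑ i ∈ Ico 1 j, F i * F j * F k

theorem sum_Ico_eq_sum_ite_lt {B : Type*} [AddCommMonoid B] {M j : ℕ} (hj : j ≤ M + 1)
    (f : ℕ → B) :
    ∑ i ∈ Ico 1 j, f i = ∑ i ∈ Ico 1 (M + 1), if i < j then f i else 0 := by
  rw [← sum_filter]
  refine sum_congr ?_ fun _ _ => rfl
  ext i
  simp only [mem_filter, mem_Ico]
  omega

theorem orderedSum₂_eq (M : ℕ) (F G : ℕ → A) :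
    orderedSum₂ M F G = ∑ i ∈ Ico 1 (M + 1), ∑ j ∈ Ico 1 (M + 1),
      if i < j then F i * G j else 0 := by
  rw [orderedSum₂, sum_comm]
  exact sum_congr rfl fun j hj => sum_Ico_eq_sum_ite_lt (mem_Ico.1 hj).2.le _

theorem orderedSum₃_eq (M : ℕ) (F : ℕ → A) :
    orderedSum₃ M F = ∑ i ∈ Ico 1 (M + 1), ∑ j ∈ Ico 1 (M + 1), ∑ k ∈ Ico 1 (M + 1),
      if i < j ∧ j < k then F i * F j * F k else 0 := by
  have h : orderedSum₃ M F = ∑ k ∈ Ico 1 (M + 1), ∑ j ∈ Ico 1 (M + 1), ∑ i ∈ Ico 1 (M + 1),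
      if i < j ∧ j < k then F i * F j * F k else 0 := by
    refine sum_congr rfl fun k hk => ?_
    rw [sum_Ico_eq_sum_ite_lt (mem_Ico.1 hk).2.le]
    refine sum_congr rfl fun j hj => ?_
    split_ifs with hjk
    · rw [sum_Ico_eq_sum_ite_lt (mem_Ico.1 hj).2.le]
      simp [hjk]
    · simp [hjk]
  rw [h]
  calc _ = ∑ k ∈ Ico 1 (M + 1), ∑ i ∈ Ico 1 (M + 1), ∑ j ∈ Ico 1 (M + 1),
        if i < j ∧ j < k then F i * F j * F k else 0 := sum_congr rfl fun _ _ => sum_comm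
    _ = ∑ i ∈ Ico 1 (M + 1), ∑ k ∈ Ico 1 (M + 1), ∑ j ∈ Ico 1 (M + 1),
        if i < j ∧ j < k then F i * F j * F k else 0 := sum_comm
    _ = _ := sum_congr rfl fun _ _ => sum_comm

/-- The first complete homogeneous symmetric sum of `x 1, …, x M`. -/
def completeSum₁ (M : ℕ) (x : ℕ → A) : A := ∑ i ∈ Ico 1 (M + 1), x i

/-- The second complete homogeneous symmetric sum of `x 1, …, x M`. -/
def completeSum₂ (M : ℕ) (x : ℕ → A) : A :=
  orderedSum₂ M x x + ∑ i ∈ Ico 1 (M + 1), x i ^ 2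

/-- The third complete homogeneous symmetric sum of `x 1, …, x M`. -/
def completeSum₃ (M : ℕ) (x : ℕ → A) : A :=
  orderedSum₃ M x + orderedSum₂ M (fun i => x i ^ 2) x + orderedSum₂ M x (fun i => x i ^ 2)
    + ∑ i ∈ Ico 1 (M + 1), x i ^ 3

theorem completeSum₁_succ (M : ℕ) (x : ℕ → A) :
    completeSum₁ (M + 1) x = completeSum₁ M x + x (M + 1) :=
  sum_Ico_succ_top (by omega) _

theorem orderedSum₂_succ (M : ℕ) (F G : ℕ → A) :
    orderedSum₂ (M + 1) F G
      = orderedSum₂ M F G + (∑ i ∈ Ico 1 (M + 1), F i) * G (M + 1) := by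
  rw [orderedSum₂, sum_Ico_succ_top (by omega), ← sum_mul]
  rfl

theorem orderedSum₃_succ (M : ℕ) (F : ℕ → A) :
    orderedSum₃ (M + 1) F = orderedSum₃ M F + orderedSum₂ M F F * F (M + 1) := by
  rw [orderedSum₃, sum_Ico_succ_top (by omega)]
  simp only [← sum_mul]
  simp only [orderedSum₃, orderedSum₂, sum_mul]

theorem completeSum₂_succ (M : ℕ) (x : ℕ → A) :
    completeSum₂ (M + 1) x
      = completeSum₂ M x + x (M + 1) * completeSum₁ (M + 1) x := by
  rw [completeSum₁_succ, completeSum₂, orderedSum₂_succ,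
    sum_Ico_succ_top (Nat.le_add_left 1 M) fun i => x i ^ 2, completeSum₂, completeSum₁]
  ring

theorem completeSum₃_succ (M : ℕ) (x : ℕ → A) :
    completeSum₃ (M + 1) x
      = completeSum₃ M x + x (M + 1) * completeSum₂ (M + 1) x := by
  rw [completeSum₂_succ, completeSum₁_succ, completeSum₃, orderedSum₃_succ, orderedSum₂_succ,
    orderedSum₂_succ, sum_Ico_succ_top (Nat.le_add_left 1 M) fun i => x i ^ 3, completeSum₃,
    completeSum₂, completeSum₁]
  ring

theorem pow_four_dvd_prod_sub {x g : ℕ → A} {u : A} (M : ℕ)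
    (h : ∀ i ∈ Ico 1 (M + 1), g i * (1 - x i * u) = 1) :
    u ^ 4 ∣ ∏ i ∈ Ico 1 (M + 1), g i - (1 + completeSum₁ M x * u + completeSum₂ M x * u ^ 2
      + completeSum₃ M x * u ^ 3) := by
  induction M with
  | zero => simp [completeSum₁, completeSum₂, completeSum₃, orderedSum₂, orderedSum₃]
  | succ M ih =>
    obtain ⟨r, hr⟩ := ih fun i hi => h i (by simp only [mem_Ico] at hi ⊢; omega)
    have hg := h (M + 1) (by simp)
    have h1 := completeSum₁_succ M x
    have h2 := completeSum₂_succ M x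
    have h3 := completeSum₃_succ M x
    refine ⟨(r + x (M + 1) * completeSum₃ (M + 1) x) * g (M + 1), ?_⟩
    rw [prod_Ico_succ_top (by omega)]
    linear_combination g (M + 1) * hr - (1 + completeSum₁ (M + 1) x * u
      + completeSum₂ (M + 1) x * u ^ 2 + completeSum₃ (M + 1) x * u ^ 3) * (-hg)
      - g (M + 1) * (u * h1 + u ^ 2 * h2 + u ^ 3 * h3)

theorem map_orderedSum₂ {B : Type*} [CommRing B] (φ : A →+* B) (M : ℕ) (F G : ℕ → A) :
    φ (orderedSum₂ M F G) = orderedSum₂ M (fun i => φ (F i)) (fun i => φ (G i)) := by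
  simp [orderedSum₂]

theorem map_orderedSum₃ {B : Type*} [CommRing B] (φ : A →+* B) (M : ℕ) (F : ℕ → A) :
    φ (orderedSum₃ M F) = orderedSum₃ M (fun i => φ (F i)) := by
  simp [orderedSum₃]

theorem map_completeSum₁ {B : Type*} [CommRing B] (φ : A →+* B) (M : ℕ) (x : ℕ → A) :
    φ (completeSum₁ M x) = completeSum₁ M (fun i => φ (x i)) := by
  simp [completeSum₁]

theorem map_completeSum₂ {B : Type*} [CommRing B] (φ : A →+* B) (M : ℕ) (x : ℕ → A) :
    φ (completeSum₂ M x) = completeSum₂ M (fun i => φ (x i)) := by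
  simp [completeSum₂, map_orderedSum₂]

theorem map_completeSum₃ {B : Type*} [CommRing B] (φ : A →+* B) (M : ℕ) (x : ℕ → A) :
    φ (completeSum₃ M x) = completeSum₃ M (fun i => φ (x i)) := by
  simp [completeSum₃, map_orderedSum₂, map_orderedSum₃]

/-- The combination of multiple divisor series in the sixth crank moment. -/
def divisorSeries (N : ℕ) (q : A) : A :=
  360 * orderedSum₃ N (fun i => truncPowSum N 1 (q ^ i))
    + 60 * (orderedSum₂ N (fun i => truncPowSum N 3 (q ^ i)) (fun i => truncPowSum N 1 (q ^ i))
      + orderedSum₂ N (fun i => truncPowSum N 1 (q ^ i)) (fun i => truncPowSum N 3 (q ^ i)))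
    - 60 * orderedSum₂ N (fun i => truncPowSum N 1 (q ^ i)) (fun i => truncPowSum N 1 (q ^ i))
    + 3 * ∑ i ∈ Ico 1 (N + 1), truncPowSum N 5 (q ^ i)
    - 5 * ∑ i ∈ Ico 1 (N + 1), truncPowSum N 3 (q ^ i)
    + 3 * ∑ i ∈ Ico 1 (N + 1), truncPowSum N 1 (q ^ i)

theorem map_divisorSeries {B : Type*} [CommRing B] (φ : A →+* B) (N : ℕ) (q : A) :
    φ (divisorSeries N q) = divisorSeries N (φ q) := by
  have hnat : ∀ k : ℕ, [k.AtLeastTwo] → φ (ofNat(k)) = ofNat(k) := fun k _ => map_ofNat φ k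
  simp only [divisorSeries, map_add, map_sub, map_mul, map_sum, map_pow, map_orderedSum₂,
    map_orderedSum₃, map_truncPowSum, hnat]

theorem completeSum_combination {N : ℕ} {q : A} (hq : q ^ (N + 1) = 0) :
    2 * completeSum₁ N (fun i => truncPowSum N 1 (q ^ i))
      + 120 * completeSum₂ N (fun i => truncPowSum N 1 (q ^ i))
      + 720 * completeSum₃ N (fun i => truncPowSum N 1 (q ^ i))
      = 2 * divisorSeries N q := by
  have hsq : ∀ i ∈ Ico 1 (N + 1), 6 * truncPowSum N 1 (q ^ i) ^ 2
      = truncPowSum N 3 (q ^ i) - truncPowSum N 1 (q ^ i) := fun i hi =>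
    six_mul_truncPowSum_one_sq (pow_pow_eq_zero hq (mem_Ico.1 hi).1)
  have s2 : 6 * ∑ i ∈ Ico 1 (N + 1), truncPowSum N 1 (q ^ i) ^ 2
      = ∑ i ∈ Ico 1 (N + 1), truncPowSum N 3 (q ^ i)
        - ∑ i ∈ Ico 1 (N + 1), truncPowSum N 1 (q ^ i) := by
    rw [mul_sum, ← sum_sub_distrib]
    exact sum_congr rfl hsq
  have s3 : 120 * ∑ i ∈ Ico 1 (N + 1), truncPowSum N 1 (q ^ i) ^ 3
      = ∑ i ∈ Ico 1 (N + 1), truncPowSum N 5 (q ^ i)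
        - 5 * ∑ i ∈ Ico 1 (N + 1), truncPowSum N 3 (q ^ i)
        + 4 * ∑ i ∈ Ico 1 (N + 1), truncPowSum N 1 (q ^ i) := by
    simp only [mul_sum, ← sum_sub_distrib, ← sum_add_distrib]
    exact sum_congr rfl fun i hi =>
      mul_truncPowSum_one_cube (pow_pow_eq_zero hq (mem_Ico.1 hi).1)
  have d21 : 6 * orderedSum₂ N (fun i => truncPowSum N 1 (q ^ i) ^ 2)
        (fun i => truncPowSum N 1 (q ^ i))
      = orderedSum₂ N (fun i => truncPowSum N 3 (q ^ i)) (fun i => truncPowSum N 1 (q ^ i))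
        - orderedSum₂ N (fun i => truncPowSum N 1 (q ^ i))
          (fun i => truncPowSum N 1 (q ^ i)) := by
    simp only [orderedSum₂, mul_sum, ← sum_sub_distrib]
    refine sum_congr rfl fun j hj => sum_congr rfl fun i hi => ?_
    linear_combination truncPowSum N 1 (q ^ j)
      * hsq i (by simp only [mem_Ico] at hi hj ⊢; omega)
  have d12 : 6 * orderedSum₂ N (fun i => truncPowSum N 1 (q ^ i))
        (fun i => truncPowSum N 1 (q ^ i) ^ 2)
      = orderedSum₂ N (fun i => truncPowSum N 1 (q ^ i)) (fun i => truncPowSum N 3 (q ^ i))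
        - orderedSum₂ N (fun i => truncPowSum N 1 (q ^ i))
          (fun i => truncPowSum N 1 (q ^ i)) := by
    simp only [orderedSum₂, mul_sum, ← sum_sub_distrib]
    refine sum_congr rfl fun j hj => sum_congr rfl fun i hi => ?_
    linear_combination truncPowSum N 1 (q ^ i) * hsq j hj
  rw [completeSum₁, completeSum₂, completeSum₃, divisorSeries]
  linear_combination 20 * s2 + 120 * d21 + 120 * d12 + 6 * s3

/-- The crank product expands, up to multiples of `(z + z⁻¹ - 2) ^ 4`, through the complete
homogeneous sums of the series `∑ m q^(i m)`. -/
theorem exists_crank_expansion {N : ℕ} {q z y : A} (hq : q ^ (N + 1) = 0) (hzy : z * y = 1) :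
    ∃ r, ∏ i ∈ Ico 1 (N + 1),
        truncGeom N (z * q ^ i) * truncGeom N (y * q ^ i) * (1 - q ^ i)
      = (∏ i ∈ Ico 1 (N + 1), truncGeom N (q ^ i))
        * (1 + completeSum₁ N (fun i => truncPowSum N 1 (q ^ i)) * (z + y - 2)
          + completeSum₂ N (fun i => truncPowSum N 1 (q ^ i)) * (z + y - 2) ^ 2
          + completeSum₃ N (fun i => truncPowSum N 1 (q ^ i)) * (z + y - 2) ^ 3
          + (z + y - 2) ^ 4 * r) := by
  obtain ⟨r, hr⟩ := pow_four_dvd_prod_sub (u := z + y - 2)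
    (x := fun i => truncPowSum N 1 (q ^ i))
    (g := fun i => truncGeom N (z * q ^ i) * truncGeom N (y * q ^ i) * (1 - q ^ i) ^ 2) N
    (by
      intro i hi
      have hi1 := (mem_Ico.1 hi).1
      have h1 := one_sub_sq_mul_truncPowSum_one (pow_pow_eq_zero hq hi1)
      have hz := one_sub_mul_truncGeom (mul_pow_pow_eq_zero hq z hi1)
      have hy := one_sub_mul_truncGeom (mul_pow_pow_eq_zero hq y hi1)
      have e : (1 - q ^ i) ^ 2 * (1 - truncPowSum N 1 (q ^ i) * (z + y - 2))
          = (1 - z * q ^ i) * (1 - y * q ^ i) := by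
        linear_combination (-(z + y - 2)) * h1 - (q ^ i) ^ 2 * hzy
      linear_combination truncGeom N (z * q ^ i) * truncGeom N (y * q ^ i) * e
        + (1 - y * q ^ i) * truncGeom N (y * q ^ i) * hz + hy)
  refine ⟨r, ?_⟩
  have h : ∏ i ∈ Ico 1 (N + 1), truncGeom N (z * q ^ i) * truncGeom N (y * q ^ i) * (1 - q ^ i)
      = (∏ i ∈ Ico 1 (N + 1), truncGeom N (q ^ i)) * ∏ i ∈ Ico 1 (N + 1),
        (truncGeom N (z * q ^ i) * truncGeom N (y * q ^ i) * (1 - q ^ i) ^ 2) := by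
    rw [← prod_mul_distrib]
    refine prod_congr rfl fun i hi => ?_
    have h1 := one_sub_mul_truncGeom (pow_pow_eq_zero hq (mem_Ico.1 hi).1)
    linear_combination (-(truncGeom N (z * q ^ i) * truncGeom N (y * q ^ i) * (1 - q ^ i))) * h1
  rw [h]
  linear_combination (∏ i ∈ Ico 1 (N + 1), truncGeom N (q ^ i)) * hr

end OrderedSums

/-! ### Generating polynomials of partitions and of divisor sums -/

section Coefficients

open Polynomial

theorem coeff_prod_eq_sum_partition {R : Type*} [CommRing R] {n N : ℕ} (hn : n ≤ N)
    (f : ℕ → ℕ → R) :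
    (∏ i ∈ Ico 1 (N + 1), ∑ m ∈ range (N + 1), C (f i m) * X ^ (i * m)).coeff n
      = ∑ lam : n.Partition, ∏ i ∈ Ico 1 (N + 1), f i (lam.parts.count i) := by
  have hsub : ∀ lam : n.Partition, lam.parts.toFinset ⊆ Ico 1 (N + 1) := by
    intro lam i hi
    rw [Multiset.mem_toFinset] at hi
    have h1 := lam.parts_pos hi
    have h2 := Nat.Partition.le_of_mem_parts hi
    rw [mem_Ico]
    omega
  have hterm : ∀ p : (i : ℕ) → i ∈ Ico 1 (N + 1) → ℕ,
      (∏ x ∈ (Ico 1 (N + 1)).attach, C (f x.1 (p x.1 x.2)) * X ^ (x.1 * p x.1 x.2)).coeff n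
        = if n = ∑ x ∈ (Ico 1 (N + 1)).attach, x.1 * p x.1 x.2 then
            ∏ x ∈ (Ico 1 (N + 1)).attach, f x.1 (p x.1 x.2) else 0 := by
    intro p
    rw [prod_mul_distrib, ← map_prod, prod_pow_eq_pow_sum, coeff_C_mul_X_pow]
  rw [prod_sum, finsetSum_coeff, sum_congr rfl fun p _ => hterm p, ← sum_filter]
  symm
  refine sum_bij (fun lam _ i _ => lam.parts.count i) ?_ ?_ ?_ ?_
  · intro lam _
    rw [mem_filter, mem_pi]
    refine ⟨fun i _ => mem_range.2 ?_, ?_⟩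
    · by_cases hi : i ∈ lam.parts
      · have h1 := lam.parts_pos hi
        have h2 : lam.parts.count i * i ≤ lam.parts.sum := by
          rw [sum_multiset_count]
          exact single_le_sum (f := fun m => lam.parts.count m • m) (fun _ _ => Nat.zero_le _)
            (Multiset.mem_toFinset.2 hi)
        rw [lam.parts_sum] at h2
        nlinarith
      · rw [Multiset.count_eq_zero.2 hi]
        omega
    · rw [sum_attach (Ico 1 (N + 1)) fun i => i * lam.parts.count i]
      conv_lhs => rw [← lam.parts_sum, sum_multiset_count_of_subset _ _ (hsub lam)]
      exact sum_congr rfl fun i _ => by rw [smul_eq_mul, mul_comm]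
  · intro a _ b _ hab
    refine Nat.Partition.ext (Multiset.ext.2 fun i => ?_)
    by_cases hi : i ∈ Ico 1 (N + 1)
    · exact congrFun (congrFun hab i) hi
    · rw [Multiset.count_eq_zero.2 fun h => hi (hsub a (Multiset.mem_toFinset.2 h)),
        Multiset.count_eq_zero.2 fun h => hi (hsub b (Multiset.mem_toFinset.2 h))]
  · intro p hp
    have hsum := (mem_filter.1 hp).2
    refine ⟨⟨∑ x ∈ (Ico 1 (N + 1)).attach, Multiset.replicate (p x.1 x.2) x.1, ?_, ?_⟩,
      mem_univ _, ?_⟩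
    · intro i hi
      obtain ⟨x, -, hx⟩ := Multiset.mem_sum.1 hi
      rw [Multiset.eq_of_mem_replicate hx]
      exact (mem_Ico.1 x.2).1
    · rw [Multiset.sum_sum, hsum]
      exact sum_congr rfl fun x _ => by rw [Multiset.sum_replicate, smul_eq_mul, mul_comm]
    · funext i hi
      rw [Multiset.count_sum', sum_eq_single ⟨i, hi⟩]
      · simp
      · intro x _ hx
        rw [Multiset.count_replicate, if_neg fun h => hx (Subtype.ext h)]
      · simp
  · intro lam _
    exact (prod_attach (Ico 1 (N + 1)) fun i => f i (lam.parts.count i)).symm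

theorem coeff_prod_truncGeom {n N : ℕ} (hn : n ≤ N) :
    (∏ i ∈ Ico 1 (N + 1), truncGeom N ((X : ℤ[X]) ^ i)).coeff n = partitionCount n := by
  have h := coeff_prod_eq_sum_partition hn fun _ _ => (1 : ℤ)
  simp only [prod_const_one, sum_const, card_univ, nsmul_eq_mul, mul_one, map_one, one_mul,
    pow_mul] at h
  exact h

theorem coeff_sum_truncPowSum {N b : ℕ} (hb : b ≤ N) (s : ℕ) :
    (∑ i ∈ Ico 1 (N + 1), truncPowSum N s ((X : ℤ[X]) ^ i)).coeff b = sigmaPow s b := by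
  have hcoeff : ∀ i m : ℕ, ((m : ℤ[X]) ^ s * (X ^ i) ^ m).coeff b
      = if b = m * i then (m : ℤ) ^ s else 0 := by
    intro i m
    rw [← pow_mul, mul_comm i m, ← C_eq_natCast, ← C_pow, coeff_C_mul_X_pow]
  simp only [truncPowSum, finsetSum_coeff, hcoeff]
  classical
  rw [sum_comm, sigmaPow]
  push_cast
  have hd : b.divisors = (Ico 1 (N + 1)).filter fun m => ∃ i ∈ Ico 1 (N + 1), b = m * i := by
    ext m
    simp only [Nat.mem_divisors, mem_filter, mem_Ico]
    constructor
    · rintro ⟨⟨i, rfl⟩, h0⟩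
      have hm : 0 < m := Nat.pos_of_ne_zero (left_ne_zero_of_mul h0)
      have hi : 0 < i := Nat.pos_of_ne_zero (right_ne_zero_of_mul h0)
      exact ⟨⟨hm, by nlinarith⟩, i, ⟨hi, by nlinarith⟩, rfl⟩
    · rintro ⟨⟨hm, -⟩, i, ⟨hi, -⟩, rfl⟩
      exact ⟨dvd_mul_right _ _, (Nat.mul_pos hm hi).ne'⟩
  rw [hd, sum_filter]
  refine sum_congr rfl fun m hm => ?_
  split_ifs with h
  · obtain ⟨i, hi, rfl⟩ := h
    rw [sum_eq_single i (fun j _ hj => if_neg fun h => hj ?_) (fun h => absurd hi h), if_pos rfl]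
    exact (Nat.eq_of_mul_eq_mul_left (mem_Ico.1 hm).1 h).symm
  · exact sum_eq_zero fun i hi => if_neg fun hb => h ⟨i, hi, hb⟩

theorem coeff_orderedSum₂ {N b : ℕ} (hb : b ≤ N) (s t : ℕ) :
    (orderedSum₂ N (fun i => truncPowSum N s ((X : ℤ[X]) ^ i))
      (fun i => truncPowSum N t (X ^ i))).coeff b = sigmaPow2 s t b := by
  have hcoeff : ∀ i j m₁ m₂ : ℕ,
      (((m₁ : ℤ[X]) ^ s * (X ^ i) ^ m₁) * ((m₂ : ℤ[X]) ^ t * (X ^ j) ^ m₂)).coeff b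
      = if m₁ * i + m₂ * j = b then (m₁ : ℤ) ^ s * (m₂ : ℤ) ^ t else 0 := by
    intro i j m₁ m₂
    rw [show ((m₁ : ℤ[X]) ^ s * (X ^ i) ^ m₁) * ((m₂ : ℤ[X]) ^ t * (X ^ j) ^ m₂)
      = C ((m₁ : ℤ) ^ s * (m₂ : ℤ) ^ t) * X ^ (m₁ * i + m₂ * j) by
        simp only [map_mul, map_pow, map_natCast]; ring, coeff_C_mul_X_pow]
    exact if_congr eq_comm rfl rfl
  have hfilter : ((Icc 1 b ×ˢ Icc 1 b) ×ˢ (Icc 1 b ×ˢ Icc 1 b)).filter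
      (fun p => p.1.1 * p.2.1 + p.1.2 * p.2.2 = b ∧ p.2.1 < p.2.2)
      = ((Ico 1 (N + 1) ×ˢ Ico 1 (N + 1)) ×ˢ (Ico 1 (N + 1) ×ˢ Ico 1 (N + 1))).filter
      (fun p => p.1.1 * p.2.1 + p.1.2 * p.2.2 = b ∧ p.2.1 < p.2.2) := by
    ext ⟨⟨m₁, m₂⟩, n₁, n₂⟩
    simp only [mem_filter, mem_product, mem_Icc, mem_Ico]
    constructor
    · rintro ⟨h, h'⟩
      exact ⟨by omega, h'⟩
    · rintro ⟨⟨⟨⟨a1, -⟩, a2, -⟩, ⟨a3, -⟩, a4, -⟩, rfl, h'⟩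
      refine ⟨⟨⟨⟨a1, ?_⟩, a2, ?_⟩, ⟨a3, ?_⟩, a4, ?_⟩, rfl, h'⟩ <;> nlinarith
  rw [sigmaPow2, hfilter, sum_filter, sum_product, sum_comm, sum_product, orderedSum₂_eq,
    finsetSum_coeff, Nat.cast_sum]
  refine sum_congr rfl fun i _ => ?_
  rw [finsetSum_coeff, Nat.cast_sum]
  refine sum_congr rfl fun j _ => ?_
  rw [sum_product]
  split_ifs with hij
  · simp only [truncPowSum, sum_mul_sum, finsetSum_coeff, hcoeff, hij, and_true]
    push_cast
    rfl
  · simp [hij]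

theorem coeff_orderedSum₃ {N b : ℕ} (hb : b ≤ N) :
    (orderedSum₃ N (fun i => truncPowSum N 1 ((X : ℤ[X]) ^ i))).coeff b
      = sigmaPow3 1 1 1 b := by
  have hcoeff : ∀ i j k m₁ m₂ m₃ : ℕ,
      (((m₁ : ℤ[X]) ^ 1 * (X ^ i) ^ m₁) * ((m₂ : ℤ[X]) ^ 1 * (X ^ j) ^ m₂)
        * ((m₃ : ℤ[X]) ^ 1 * (X ^ k) ^ m₃)).coeff b
      = if m₁ * i + m₂ * j + m₃ * k = b then (m₁ : ℤ) ^ 1 * (m₂ : ℤ) ^ 1 * (m₃ : ℤ) ^ 1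
        else 0 := by
    intro i j k m₁ m₂ m₃
    rw [show ((m₁ : ℤ[X]) ^ 1 * (X ^ i) ^ m₁) * ((m₂ : ℤ[X]) ^ 1 * (X ^ j) ^ m₂)
        * ((m₃ : ℤ[X]) ^ 1 * (X ^ k) ^ m₃)
      = C ((m₁ : ℤ) ^ 1 * (m₂ : ℤ) ^ 1 * (m₃ : ℤ) ^ 1) * X ^ (m₁ * i + m₂ * j + m₃ * k) by
        simp only [map_mul, map_pow, map_natCast]; ring, coeff_C_mul_X_pow]
    exact if_congr eq_comm rfl rfl
  have hfilter : ((Icc 1 b ×ˢ Icc 1 b ×ˢ Icc 1 b) ×ˢ (Icc 1 b ×ˢ Icc 1 b ×ˢ Icc 1 b)).filter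
      (fun p => p.1.1 * p.2.1 + p.1.2.1 * p.2.2.1 + p.1.2.2 * p.2.2.2 = b
        ∧ p.2.1 < p.2.2.1 ∧ p.2.2.1 < p.2.2.2)
      = ((Ico 1 (N + 1) ×ˢ Ico 1 (N + 1) ×ˢ Ico 1 (N + 1)) ×ˢ
        (Ico 1 (N + 1) ×ˢ Ico 1 (N + 1) ×ˢ Ico 1 (N + 1))).filter
      (fun p => p.1.1 * p.2.1 + p.1.2.1 * p.2.2.1 + p.1.2.2 * p.2.2.2 = b
        ∧ p.2.1 < p.2.2.1 ∧ p.2.2.1 < p.2.2.2) := by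
    ext ⟨⟨m₁, m₂, m₃⟩, n₁, n₂, n₃⟩
    simp only [mem_filter, mem_product, mem_Icc, mem_Ico]
    constructor
    · rintro ⟨h, h'⟩
      exact ⟨by omega, h'⟩
    · rintro ⟨⟨⟨⟨a1, -⟩, ⟨a2, -⟩, a3, -⟩, ⟨a4, -⟩, ⟨a5, -⟩, a6, -⟩, rfl, h'⟩
      refine ⟨⟨⟨⟨a1, ?_⟩, ⟨a2, ?_⟩, a3, ?_⟩, ⟨a4, ?_⟩, ⟨a5, ?_⟩, a6, ?_⟩, rfl, h'⟩ <;>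
        nlinarith
  have hmul : ∀ f g h : ℕ → ℤ[X], (∑ m₁ ∈ Ico 1 (N + 1), f m₁) * (∑ m₂ ∈ Ico 1 (N + 1), g m₂)
      * (∑ m₃ ∈ Ico 1 (N + 1), h m₃) = ∑ m₁ ∈ Ico 1 (N + 1), ∑ m₂ ∈ Ico 1 (N + 1),
        ∑ m₃ ∈ Ico 1 (N + 1), f m₁ * g m₂ * h m₃ := by
    intro f g h
    rw [sum_mul_sum, sum_mul]
    refine sum_congr rfl fun _ _ => ?_
    rw [sum_mul]
    exact sum_congr rfl fun _ _ => mul_sum _ _ _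
  rw [sigmaPow3, hfilter, sum_filter, sum_product, sum_comm, sum_product, orderedSum₃_eq,
    finsetSum_coeff, Nat.cast_sum]
  refine sum_congr rfl fun i _ => ?_
  rw [finsetSum_coeff, sum_product, Nat.cast_sum]
  refine sum_congr rfl fun j _ => ?_
  rw [finsetSum_coeff, Nat.cast_sum]
  refine sum_congr rfl fun k _ => ?_
  simp only [sum_product]
  split_ifs with hijk
  · simp only [truncPowSum, hmul, finsetSum_coeff, hcoeff, hijk, and_true]
    push_cast
    rfl
  · simp [hijk]

theorem coeff_divisorSeries {N b : ℕ} (hb : b ≤ N) :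
    (divisorSeries N (X : ℤ[X])).coeff b
      = 360 * (sigmaPow3 1 1 1 b : ℤ) + 60 * ((sigmaPow2 3 1 b : ℤ) + (sigmaPow2 1 3 b : ℤ))
        - 60 * (sigmaPow2 1 1 b : ℤ) + 3 * (sigmaPow 5 b : ℤ) - 5 * (sigmaPow 3 b : ℤ)
        + 3 * (sigmaPow 1 b : ℤ) := by
  simp only [divisorSeries, coeff_add, coeff_sub, coeff_ofNat_mul, coeff_orderedSum₂ hb,
    coeff_orderedSum₃ hb, coeff_sum_truncPowSum hb]

end Coefficients

/-! ### The crank statistic -/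

section Crank

open Polynomial

theorem sup_mem_of_ne_zero {s : Multiset ℕ} (hs : s.sup ≠ 0) : s.sup ∈ s := by
  by_contra hmem
  have h : s.sup ≤ s.sup - 1 := Multiset.sup_le.2 fun b hb => by
    have h1 := Multiset.le_sup hb
    have h2 : b ≠ s.sup := fun h => hmem (h ▸ hb)
    omega
  omega

/-- The weight of a part size `i` of multiplicity `m` in the generating function of the
partitions with exactly `j` ones, where `z` marks the parts larger than `j`. -/
def onesWeight {R : Type*} [CommRing R] (z : R) (j i m : ℕ) : R :=
  if i = 1 then (if m = j then 1 else 0) else if i ≤ j then 1 else z ^ m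

/-- The weight of a part size `i` of multiplicity `m` in the generating function of the
partitions without ones and with largest part `k`, each such partition counting for `z ^ k`. -/
def largestWeight {R : Type*} [CommRing R] (z : R) (k i m : ℕ) : R :=
  if i = k then (if m = 0 then 0 else z ^ k)
  else if i = 1 ∨ k < i then (if m = 0 then 1 else 0) else 1

variable {R : Type*} [CommRing R]

theorem prod_onesWeight {n N : ℕ} (hN : 1 ≤ N) (hn : n ≤ N) (z : R) {j : ℕ} (hj : 1 ≤ j)
    (lam : n.Partition) :
    ∏ i ∈ Ico 1 (N + 1), onesWeight z j i (lam.parts.count i)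
      = if lam.parts.count 1 = j then z ^ (lam.parts.filter (fun x => j < x)).card else 0 := by
  have hcard : (lam.parts.filter (fun x => j < x)).card
      = ∑ i ∈ Ico 2 (N + 1), if j < i then lam.parts.count i else 0 := by
    rw [← Multiset.sum_count_eq_card (s := Ico 2 (N + 1))]
    · exact sum_congr rfl fun i _ => Multiset.count_filter ..
    · intro a ha
      obtain ⟨ha, hja⟩ := Multiset.mem_filter.1 ha
      have := Nat.Partition.le_of_mem_parts ha
      rw [mem_Ico]
      omega
  rw [prod_eq_prod_Ico_succ_bot (by omega), hcard, ← prod_pow_eq_pow_sum]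
  have hrest : ∏ i ∈ Ico (1 + 1) (N + 1), onesWeight z j i (lam.parts.count i)
      = ∏ i ∈ Ico 2 (N + 1), z ^ (if j < i then lam.parts.count i else 0) := by
    refine prod_congr rfl fun i hi => ?_
    have hi2 := (mem_Ico.1 hi).1
    rw [onesWeight, if_neg (by omega)]
    by_cases hij : i ≤ j
    · rw [if_pos hij, if_neg (by omega), pow_zero]
    · rw [if_neg hij, if_pos (by omega)]
  rw [hrest, onesWeight, if_pos rfl, ite_mul, one_mul, zero_mul]

theorem prod_largestWeight {n N : ℕ} (hn : n ≤ N) (z : R) {k : ℕ} (hk : k ∈ Ico 2 (N + 1))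
    (lam : n.Partition) :
    ∏ i ∈ Ico 1 (N + 1), largestWeight z k i (lam.parts.count i)
      = if lam.parts.count 1 = 0 ∧ lam.parts.sup = k then z ^ k else 0 := by
  obtain ⟨hk2, hkN⟩ := mem_Ico.1 hk
  split_ifs with h
  · obtain ⟨h1, hsup⟩ := h
    have hmem : k ∈ lam.parts := hsup ▸ sup_mem_of_ne_zero (by omega)
    have hfactor : ∀ i ∈ Ico 1 (N + 1), largestWeight z k i (lam.parts.count i)
        = if i = k then z ^ k else 1 := by
      intro i _
      rw [largestWeight]
      by_cases hik : i = k
      · rw [if_pos hik, if_pos hik, hik,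
          if_neg (Multiset.count_ne_zero.2 hmem)]
      · rw [if_neg hik, if_neg hik]
        by_cases hi : i = 1 ∨ k < i
        · rw [if_pos hi, if_pos]
          rcases hi with rfl | hi
          · exact h1
          · exact Multiset.count_eq_zero.2 fun h => by
              have := Multiset.le_sup h
              omega
        · rw [if_neg hi]
    rw [prod_congr rfl hfactor, prod_ite_eq', if_pos (mem_Ico.2 ⟨by omega, hkN⟩)]
  · by_cases h1 : lam.parts.count 1 = 0
    · have hsup : lam.parts.sup ≠ k := fun hs => h ⟨h1, hs⟩
      by_cases hmem : k ∈ lam.parts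
      · have hlt : k < lam.parts.sup := lt_of_le_of_ne (Multiset.le_sup hmem) hsup.symm
        have hs : lam.parts.sup ∈ lam.parts := sup_mem_of_ne_zero (by omega)
        have hsn := Nat.Partition.le_of_mem_parts hs
        refine prod_eq_zero (i := lam.parts.sup) (mem_Ico.2 ⟨by omega, by omega⟩) ?_
        rw [largestWeight, if_neg hsup, if_pos (Or.inr hlt),
          if_neg (Multiset.count_ne_zero.2 hs)]
      · refine prod_eq_zero (i := k) (mem_Ico.2 ⟨by omega, hkN⟩) ?_
        rw [largestWeight, if_pos rfl, if_pos (Multiset.count_eq_zero.2 hmem)]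
    · refine prod_eq_zero (i := 1) (mem_Ico.2 ⟨le_rfl, by omega⟩) ?_
      rw [largestWeight, if_neg (by omega), if_pos (Or.inl rfl), if_neg h1]

theorem T_crank_eq {n N : ℕ} (hn2 : 2 ≤ n) (hn : n ≤ N) (lam : n.Partition) :
    (LaurentPolynomial.T (crank lam) : LaurentPolynomial ℤ)
      = ∑ k ∈ Ico 2 (N + 1), ∏ i ∈ Ico 1 (N + 1),
          largestWeight (LaurentPolynomial.T 1) k i (lam.parts.count i)
        + ∑ j ∈ Ico 1 (N + 1), LaurentPolynomial.T (-1) ^ j * ∏ i ∈ Ico 1 (N + 1),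
          onesWeight (LaurentPolynomial.T 1) j i (lam.parts.count i) := by
  have hlargest : ∑ k ∈ Ico 2 (N + 1), ∏ i ∈ Ico 1 (N + 1),
      largestWeight (LaurentPolynomial.T 1 : LaurentPolynomial ℤ) k i (lam.parts.count i)
      = ∑ k ∈ Ico 2 (N + 1), if lam.parts.count 1 = 0 ∧ lam.parts.sup = k
          then (LaurentPolynomial.T 1 : LaurentPolynomial ℤ) ^ k else 0 :=
    sum_congr rfl fun k hk => prod_largestWeight hn _ hk lam
  have hones : ∑ j ∈ Ico 1 (N + 1), (LaurentPolynomial.T (-1) : LaurentPolynomial ℤ) ^ j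
      * ∏ i ∈ Ico 1 (N + 1), onesWeight (LaurentPolynomial.T 1) j i (lam.parts.count i)
      = ∑ j ∈ Ico 1 (N + 1), (LaurentPolynomial.T (-1) : LaurentPolynomial ℤ) ^ j
        * if lam.parts.count 1 = j then
            LaurentPolynomial.T 1 ^ (lam.parts.filter (fun x => j < x)).card else 0 :=
    sum_congr rfl fun j hj => by rw [prod_onesWeight (by omega) hn _ (mem_Ico.1 hj).1 lam]
  rw [hlargest, hones]
  by_cases h1 : lam.parts.count 1 = 0
  · have hs0 : lam.parts.sup ≠ 0 := by
      intro h0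
      have hall : ∀ a ∈ lam.parts, a = 0 := fun a ha => by
        have := Multiset.le_sup ha
        omega
      have := lam.parts_sum
      rw [Multiset.sum_eq_zero hall] at this
      omega
    have hs := sup_mem_of_ne_zero hs0
    have hs1 : lam.parts.sup ≠ 1 := fun h => Multiset.count_eq_zero.1 h1 (h ▸ hs)
    have hsn := Nat.Partition.le_of_mem_parts hs
    rw [sum_eq_single lam.parts.sup, sum_eq_zero, crank, if_pos h1, if_pos ⟨h1, rfl⟩,
      LaurentPolynomial.T_pow, mul_one, add_zero]
    · intro j hj
      rw [if_neg (by have := (mem_Ico.1 hj).1; omega), mul_zero]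
    · intro k _ hk
      exact if_neg fun h => hk h.2.symm
    · intro h
      exact absurd (mem_Ico.2 ⟨by omega, by omega⟩) h
  · have hle : lam.parts.count 1 ≤ n := by
      have h2 : lam.parts.count 1 * 1 ≤ lam.parts.sum := by
        rw [sum_multiset_count]
        exact single_le_sum (f := fun m => lam.parts.count m • m) (fun _ _ => Nat.zero_le _)
          (Multiset.mem_toFinset.2 (Multiset.count_ne_zero.1 h1))
      rw [lam.parts_sum] at h2
      omega
    rw [sum_eq_zero fun k _ => if_neg fun h => h1 h.1, sum_eq_single (lam.parts.count 1),
      crank, if_neg h1, if_pos rfl, LaurentPolynomial.T_pow, LaurentPolynomial.T_pow,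
      ← LaurentPolynomial.T_add, zero_add]
    · congr 1
      ring
    · intro j _ hj
      rw [if_neg fun h => hj h.symm, mul_zero]
    · intro h
      exact absurd (mem_Ico.2 ⟨by omega, by omega⟩) h

theorem prod_sum_onesWeight {N j : ℕ} (hj : j ∈ Ico 1 (N + 1)) (z : R) :
    ∏ i ∈ Ico 1 (N + 1), ∑ m ∈ range (N + 1), C (onesWeight z j i m) * (X : R[X]) ^ (i * m)
      = X ^ j * (∏ i ∈ Ico 2 (j + 1), truncGeom N (X ^ i))
        * ∏ i ∈ Ico (j + 1) (N + 1), truncGeom N (C z * X ^ i) := by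
  obtain ⟨hj1, hjN⟩ := mem_Ico.1 hj
  rw [prod_eq_prod_Ico_succ_bot (by omega), mul_assoc,
    ← prod_Ico_consecutive _ (show 1 + 1 ≤ j + 1 by omega) (show j + 1 ≤ N + 1 by omega)]
  congr 1
  · simp [onesWeight, ite_mul, hjN]
  · congr 1
    · refine prod_congr rfl fun i hi => sum_congr rfl fun m _ => ?_
      have := mem_Ico.1 hi
      rw [onesWeight, if_neg (by omega), if_pos (by omega), map_one, one_mul, pow_mul]
    · refine prod_congr rfl fun i hi => sum_congr rfl fun m _ => ?_
      have := mem_Ico.1 hi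
      rw [onesWeight, if_neg (by omega), if_neg (by omega), mul_pow, pow_mul, map_pow]

theorem prod_sum_largestWeight {N k : ℕ} (hk : k ∈ Ico 2 (N + 1)) (z : R) :
    ∏ i ∈ Ico 1 (N + 1), ∑ m ∈ range (N + 1), C (largestWeight z k i m) * (X : R[X]) ^ (i * m)
      = C z ^ k * (truncGeom N (X ^ k) - 1) * ∏ i ∈ Ico 2 k, truncGeom N (X ^ i) := by
  obtain ⟨hk2, hkN⟩ := mem_Ico.1 hk
  rw [prod_eq_prod_Ico_succ_bot (by omega),
    ← prod_Ico_consecutive _ (show 1 + 1 ≤ k by omega) (show k ≤ N + 1 by omega),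
    prod_eq_prod_Ico_succ_bot hkN]
  have hone : ∀ i, i ≠ k → (i = 1 ∨ k < i) →
      ∑ m ∈ range (N + 1), C (largestWeight z k i m) * (X : R[X]) ^ (i * m) = 1 := by
    intro i hik hi
    rw [sum_range_succ', sum_eq_zero]
    · simp [largestWeight, hik, hi]
    · intro m _
      simp [largestWeight, hik, hi]
  have hmid : ∑ m ∈ range (N + 1), C (largestWeight z k k m) * (X : R[X]) ^ (k * m)
      = C z ^ k * (truncGeom N (X ^ k) - 1) := by
    rw [truncGeom, sum_range_succ', sum_range_succ']
    simp [largestWeight, mul_sum, pow_mul]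
  rw [hone 1 (by omega) (Or.inl rfl), hmid, prod_eq_one (s := Ico (k + 1) (N + 1))]
  · have hlow : ∏ i ∈ Ico (1 + 1) k,
        ∑ m ∈ range (N + 1), C (largestWeight z k i m) * (X : R[X]) ^ (i * m)
        = ∏ i ∈ Ico 2 k, truncGeom N (X ^ i) := by
      refine prod_congr rfl fun i hi => sum_congr rfl fun m _ => ?_
      have := mem_Ico.1 hi
      rw [largestWeight, if_neg (by omega), if_neg (by omega), map_one, one_mul, pow_mul]
    rw [hlow]
    ring
  · intro i hi
    have := mem_Ico.1 hi
    exact hone i (by omega) (Or.inr (by omega))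

theorem exists_truncation.{u} (R : Type u) [CommRing R] (n : ℕ) :
    ∃ (A : Type u) (_ : CommRing A) (π : R[X] →+* A),
      Function.Surjective π ∧ ∀ f, π f = 0 ↔ X ^ n ∣ f :=
  ⟨R[X] ⧸ Ideal.span {(X : R[X]) ^ n}, inferInstance, Ideal.Quotient.mk _,
    Ideal.Quotient.mk_surjective,
    fun _ => Ideal.Quotient.eq_zero_iff_mem.trans Ideal.mem_span_singleton⟩

/-- The crank generating function: for `2 ≤ n`, its `n`-th coefficient is read off from the
expansion of the crank product. -/
theorem exists_sum_T_crank {n : ℕ} (hn : 2 ≤ n) :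
    ∃ r : (LaurentPolynomial ℤ)[X],
      ∑ lam : n.Partition, (LaurentPolynomial.T (crank lam) : LaurentPolynomial ℤ)
      = ((∏ i ∈ Ico 1 (n + 1), truncGeom n ((X : (LaurentPolynomial ℤ)[X]) ^ i))
        * (1 + completeSum₁ n (fun i => truncPowSum n 1 (X ^ i))
            * C (LaurentPolynomial.T 1 + LaurentPolynomial.T (-1) - 2)
          + completeSum₂ n (fun i => truncPowSum n 1 (X ^ i))
            * C (LaurentPolynomial.T 1 + LaurentPolynomial.T (-1) - 2) ^ 2
          + completeSum₃ n (fun i => truncPowSum n 1 (X ^ i))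
            * C (LaurentPolynomial.T 1 + LaurentPolynomial.T (-1) - 2) ^ 3
          + C (LaurentPolynomial.T 1 + LaurentPolynomial.T (-1) - 2) ^ 4 * r)).coeff n := by
  set z : LaurentPolynomial ℤ := LaurentPolynomial.T 1 with hz
  set y : LaurentPolynomial ℤ := LaurentPolynomial.T (-1) with hy
  have hzy : z * y = 1 := by
    rw [hz, hy, ← LaurentPolynomial.T_add, add_neg_cancel, LaurentPolynomial.T_zero]
  obtain ⟨A, _, π, hsurj, hker⟩ := exists_truncation (LaurentPolynomial ℤ) (n + 1)
  have hq : π X ^ (n + 1) = 0 := by rw [← map_pow, hker]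
  have hzy' : π (C z) * π (C y) = 1 := by rw [← map_mul, ← map_mul, hzy, map_one, map_one]
  obtain ⟨r', hr⟩ := exists_crank_expansion hq hzy'
  obtain ⟨r, rfl⟩ := hsurj r'
  refine ⟨r, ?_⟩
  set E : (LaurentPolynomial ℤ)[X] := (∏ i ∈ Ico 1 (n + 1), truncGeom n (X ^ i))
        * (1 + completeSum₁ n (fun i => truncPowSum n 1 (X ^ i)) * C (z + y - 2)
          + completeSum₂ n (fun i => truncPowSum n 1 (X ^ i)) * C (z + y - 2) ^ 2
          + completeSum₃ n (fun i => truncPowSum n 1 (X ^ i)) * C (z + y - 2) ^ 3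
          + C (z + y - 2) ^ 4 * r) with hE
  set S : (LaurentPolynomial ℤ)[X] := ∑ k ∈ Ico 2 (n + 1), ∏ i ∈ Ico 1 (n + 1),
        ∑ m ∈ range (n + 1), C (largestWeight z k i m) * X ^ (i * m)
      + ∑ j ∈ Ico 1 (n + 1), C (y ^ j) * ∏ i ∈ Ico 1 (n + 1),
        ∑ m ∈ range (n + 1), C (onesWeight z j i m) * X ^ (i * m) with hS
  have hcoeffS : S.coeff n = ∑ lam : n.Partition, LaurentPolynomial.T (crank lam) := by
    rw [sum_congr rfl fun lam _ => T_crank_eq hn le_rfl lam, sum_add_distrib, sum_comm, hS,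
      coeff_add, finsetSum_coeff, finsetSum_coeff]
    congr 1
    · exact sum_congr rfl fun k _ => coeff_prod_eq_sum_partition le_rfl _
    · rw [sum_comm]
      refine sum_congr rfl fun j _ => ?_
      rw [coeff_C_mul, coeff_prod_eq_sum_partition le_rfl, mul_sum]
  have hπ : π (S - (E - (1 - X) - C z * X)) = 0 := by
    have hu : π (C (z + y - 2)) = π (C z) + π (C y) - 2 := by
      rw [C_sub, C_add, map_sub, map_add]
      congr 1
      exact (congrArg π (map_ofNat C 2)).trans (map_ofNat π 2)
    have hπE : π E = ∏ i ∈ Ico 1 (n + 1), truncGeom n (π (C z) * π X ^ i)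
        * truncGeom n (π (C y) * π X ^ i) * (1 - π X ^ i) := by
      rw [hr, hE, map_mul, map_add, map_add, map_add, map_add, map_prod]
      simp only [map_mul, map_pow, map_one, hu, map_truncGeom, map_completeSum₁,
        map_completeSum₂, map_completeSum₃, map_truncPowSum]
    have hπS : π S = ∑ k ∈ Ico 2 (n + 1), π (C z) ^ k * π X ^ k
          * ∏ i ∈ Ico 2 (k + 1), truncGeom n (π X ^ i)
        + ∑ j ∈ Ico 1 (n + 1), π (C y) ^ j * π X ^ j
          * (∏ i ∈ Ico 2 (j + 1), truncGeom n (π X ^ i))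
          * ∏ i ∈ Ico (j + 1) (n + 1), truncGeom n (π (C z) * π X ^ i) := by
      rw [hS, map_add, map_sum, map_sum]
      congr 1
      · refine sum_congr rfl fun k hk => ?_
        have hk2 := (mem_Ico.1 hk).1
        rw [prod_sum_largestWeight hk, prod_Ico_succ_top hk2]
        simp only [map_mul, map_sub, map_pow, map_one, map_prod, map_truncGeom]
        have hg := one_sub_mul_truncGeom (pow_pow_eq_zero hq (show 1 ≤ k by omega))
        linear_combination (π (C z) ^ k * ∏ i ∈ Ico 2 k, truncGeom n (π X ^ i)) * hg
      · refine sum_congr rfl fun j hj => ?_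
        rw [prod_sum_onesWeight hj]
        simp only [map_mul, map_pow, map_prod, map_truncGeom]
        ring
    rw [map_sub, map_sub, map_sub, map_sub, map_mul π (C z) X, map_one, hπS, hπE,
      crank_product (by omega) hq hzy', sub_self]
  have h0 := X_pow_dvd_iff.1 ((hker _).1 hπ) n (Nat.lt_succ_self n)
  simp only [coeff_sub, coeff_C_mul, coeff_one, coeff_X, if_neg (show ¬ n = 0 by omega),
    if_neg (show ¬ 1 = n by omega), mul_zero, sub_zero] at h0
  rw [← hcoeffS]
  exact sub_eq_zero.1 h0

end Crank

/-! ### Moments of Laurent polynomials -/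

section Moments

open LaurentPolynomial

/-- The additive functional on Laurent polynomials sending `T k` to `g k`. -/
noncomputable def laurentFunctional (g : ℤ → ℤ) : ℤ[T;T⁻¹] →+ ℤ :=
  (Finsupp.linearCombination ℤ g).toAddMonoidHom.comp
    AddMonoidAlgebra.coeffAddEquiv.toAddMonoidHom

theorem laurentFunctional_C_mul_T (g : ℤ → ℤ) (a k : ℤ) :
    laurentFunctional g (C a * T k) = a * g k := by
  rw [← single_eq_C_mul_T]
  change Finsupp.linearCombination ℤ g (Finsupp.single k a) = a * g k
  rw [Finsupp.linearCombination_single, smul_eq_mul]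

theorem laurentFunctional_T (g : ℤ → ℤ) (k : ℤ) : laurentFunctional g (T k) = g k := by
  simpa using laurentFunctional_C_mul_T g 1 k

theorem laurentFunctional_mul (g : ℤ → ℤ) (f : ℤ[T;T⁻¹]) :
    laurentFunctional g ((T 1 + T (-1) - 2) * f)
      = laurentFunctional (fun k => g (k + 1) + g (k - 1) - 2 * g k) f := by
  induction f using LaurentPolynomial.induction_on' with
  | add p q hp hq => rw [mul_add, map_add, map_add, hp, hq]
  | C_mul_T k a =>
    have e : (T 1 + T (-1) - 2) * (C a * T k : ℤ[T;T⁻¹])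
        = C a * T (k + 1) + C a * T (k - 1) - 2 • (C a * T k) := by
      rw [T_add, T_sub, two_nsmul]
      ring
    rw [e, map_sub, map_add, map_nsmul]
    simp only [laurentFunctional_C_mul_T, nsmul_eq_mul]
    push_cast
    ring

end Moments

theorem sixth_crank_moment (n : ℕ) (hn : 2 ≤ n) :
    ∑ lam : Nat.Partition n, crank lam ^ 6
      = 2 * ∑ a ∈ Finset.range n, (partitionCount a : ℤ)
          * (360 * (sigmaPow3 1 1 1 (n - a) : ℤ)
            + 60 * ((sigmaPow2 3 1 (n - a) : ℤ) + (sigmaPow2 1 3 (n - a) : ℤ))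
            - 60 * (sigmaPow2 1 1 (n - a) : ℤ)
            + 3 * (sigmaPow 5 (n - a) : ℤ)
            - 5 * (sigmaPow 3 (n - a) : ℤ)
            + 3 * (sigmaPow 1 (n - a) : ℤ)) := by
  obtain ⟨r, hr⟩ := exists_sum_T_crank hn
  set u : LaurentPolynomial ℤ := LaurentPolynomial.T 1 + LaurentPolynomial.T (-1) - 2 with hu
  set P : Polynomial ℤ := ∏ i ∈ Ico 1 (n + 1), truncGeom n (Polynomial.X ^ i) with hP
  set c₁ : Polynomial ℤ := completeSum₁ n (fun i => truncPowSum n 1 (Polynomial.X ^ i)) with hc₁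
  set c₂ : Polynomial ℤ := completeSum₂ n (fun i => truncPowSum n 1 (Polynomial.X ^ i)) with hc₂
  set c₃ : Polynomial ℤ := completeSum₃ n (fun i => truncPowSum n 1 (Polynomial.X ^ i)) with hc₃
  let φ : Polynomial ℤ →+* Polynomial (LaurentPolynomial ℤ) :=
    Polynomial.mapRingHom (Int.castRingHom _)
  have hφX : φ Polynomial.X = Polynomial.X := Polynomial.map_X _
  have hφ : ∀ p : Polynomial ℤ, ∀ k : ℕ, (φ p * Polynomial.C u ^ k).coeff n
      = p.coeff n • u ^ k := by
    intro p k
    rw [← Polynomial.C_pow, Polynomial.coeff_mul_C, zsmul_eq_mul]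
    congr 1
    exact Polynomial.coeff_map _ _
  set L := laurentFunctional fun k => k ^ 6 with hL
  have hL0 : L 1 = 0 := by
    rw [← LaurentPolynomial.T_zero, hL, laurentFunctional_T]; norm_num
  have hL1 : L u = 2 := by
    rw [← mul_one u, ← LaurentPolynomial.T_zero, hL, laurentFunctional_mul, laurentFunctional_T]
    norm_num
  have hL2 : L (u ^ 2) = 120 := by
    rw [pow_two, ← mul_one (u * u), ← LaurentPolynomial.T_zero, mul_assoc, hL,
      laurentFunctional_mul, laurentFunctional_mul, laurentFunctional_T]
    norm_num
  have hL3 : L (u ^ 3) = 720 := by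
    rw [show u ^ 3 = u * (u * (u * 1)) by ring, ← LaurentPolynomial.T_zero, hL,
      laurentFunctional_mul, laurentFunctional_mul, laurentFunctional_mul, laurentFunctional_T]
    norm_num
  have hL4 : ∀ f, L (u ^ 4 * f) = 0 := by
    intro f
    rw [show u ^ 4 * f = u * (u * (u * (u * f))) by ring, hL, laurentFunctional_mul,
      laurentFunctional_mul, laurentFunctional_mul, laurentFunctional_mul]
    ring_nf
    simp [laurentFunctional, Finsupp.linearCombination_apply]
  have hexp : ∑ lam : Nat.Partition n,
      (LaurentPolynomial.T (crank lam) : LaurentPolynomial ℤ)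
      = P.coeff n • 1 + (P * c₁).coeff n • u + (P * c₂).coeff n • u ^ 2
        + (P * c₃).coeff n • u ^ 3
        + u ^ 4 * (φ P * r).coeff n := by
    have h0 := hφ P 0
    have h1 := hφ (P * c₁) 1
    have h2 := hφ (P * c₂) 2
    have h3 := hφ (P * c₃) 3
    rw [pow_zero, pow_zero] at h0
    rw [pow_one, pow_one] at h1
    rw [← h0, ← h1, ← h2, ← h3, ← Polynomial.coeff_C_mul, ← Polynomial.coeff_add,
      ← Polynomial.coeff_add, ← Polynomial.coeff_add, ← Polynomial.coeff_add, hr]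
    congr 1
    simp only [hP, hc₁, hc₂, hc₃, map_mul, map_prod, map_truncGeom, map_completeSum₁,
      map_completeSum₂, map_completeSum₃, map_truncPowSum, map_pow, hφX]
    ring
  have hmoment : ∑ lam : Nat.Partition n, crank lam ^ 6
      = (P * (2 * c₁ + 120 * c₂ + 720 * c₃)).coeff n := by
    have h := congrArg L hexp
    simp only [map_sum, map_add, map_zsmul, hL0, hL1, hL2, hL3, hL4, smul_eq_mul] at h
    rw [sum_congr rfl fun lam _ => (laurentFunctional_T (fun k => k ^ 6) (crank lam)).symm]
    rw [h, show P * (2 * c₁ + 120 * c₂ + 720 * c₃)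
      = 2 * (P * c₁) + 120 * (P * c₂) + 720 * (P * c₃) by ring]
    simp only [Polynomial.coeff_add, Polynomial.coeff_ofNat_mul]
    ring
  have hcongr : (P * (2 * c₁ + 120 * c₂ + 720 * c₃)).coeff n
      = (2 * (P * divisorSeries n Polynomial.X)).coeff n := by
    obtain ⟨A, _, π, -, hker⟩ := exists_truncation ℤ (n + 1)
    have hq : π Polynomial.X ^ (n + 1) = 0 := by rw [← map_pow, hker]
    have hπ : π (P * (2 * c₁ + 120 * c₂ + 720 * c₃)
        - 2 * (P * divisorSeries n Polynomial.X)) = 0 := by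
      have h := completeSum_combination hq
      have hnat : ∀ k : ℕ, [k.AtLeastTwo] → π (ofNat(k)) = ofNat(k) := fun k _ => map_ofNat π k
      simp only [map_sub, map_add, map_mul, hc₁, hc₂, hc₃, hnat, map_completeSum₁,
        map_completeSum₂, map_completeSum₃, map_truncPowSum, map_pow, map_divisorSeries]
      linear_combination π P * h
    have h0 := Polynomial.X_pow_dvd_iff.1 ((hker _).1 hπ) n (Nat.lt_succ_self n)
    rw [Polynomial.coeff_sub] at h0
    exact sub_eq_zero.1 h0
  rw [hmoment, hcongr, Polynomial.coeff_ofNat_mul, Polynomial.coeff_mul,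
    Nat.sum_antidiagonal_eq_sum_range_succ fun a b =>
      P.coeff a * (divisorSeries n (Polynomial.X : Polynomial ℤ)).coeff b,
    sum_range_succ]
  have hlast : (divisorSeries n (Polynomial.X : Polynomial ℤ)).coeff (n - n) = 0 := by
    rw [coeff_divisorSeries (by omega), Nat.sub_self]
    simp [sigmaPow, sigmaPow2, sigmaPow3]
  rw [hlast, mul_zero, add_zero]
  congr 1
  refine sum_congr rfl fun a ha => ?_
  rw [hP, coeff_prod_truncGeom (mem_range.1 ha).le, coeff_divisorSeries (Nat.sub_le n a)]
end

section
/- For every integer n ≥ 2, n·Σ_{λ ⊢ n} crank(λ)^2 = −(1/3)·Σ_{a=0}^{n-1} p(a)·(12·σ_{(1,1)}(n−a) − 4·σ_3(n−a) − 2·σ_1(n−a)). -/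
open Finset

/-- The quadruples `((a, b), (x, y))` of positive integers with `a * x + b * y = n`. -/
def quadruples (n : ℕ) : Finset ((ℕ × ℕ) × (ℕ × ℕ)) :=
  ((Icc 1 n ×ˢ Icc 1 n) ×ˢ (Icc 1 n ×ˢ Icc 1 n)).filter
    fun p => p.1.1 * p.2.1 + p.1.2 * p.2.2 = n

theorem mem_quadruples {n : ℕ} {p : (ℕ × ℕ) × (ℕ × ℕ)} :
    p ∈ quadruples n ↔ 0 < p.1.1 ∧ 0 < p.1.2 ∧ 0 < p.2.1 ∧ 0 < p.2.2 ∧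
      p.1.1 * p.2.1 + p.1.2 * p.2.2 = n := by
  obtain ⟨⟨a, b⟩, x, y⟩ := p
  simp only [quadruples, mem_filter, mem_product, mem_Icc]
  refine ⟨fun h => ⟨h.1.1.1.1, h.1.1.2.1, h.1.2.1.1, h.1.2.2.1, h.2⟩, ?_⟩
  rintro ⟨ha, hb, hx, hy, h⟩
  have h1 := Nat.le_mul_of_pos_right a hx
  have h2 := Nat.le_mul_of_pos_left x ha
  have h3 := Nat.le_mul_of_pos_right b hy
  have h4 := Nat.le_mul_of_pos_left y hb
  refine ⟨⟨⟨⟨ha, ?_⟩, hb, ?_⟩, ⟨hx, ?_⟩, hy, ?_⟩, h⟩ <;> omega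

theorem sum_quadruples_dual (n : ℕ) (h : ℕ → ℕ → ℕ → ℕ → ℚ) :
    ∑ p ∈ quadruples n, h p.1.1 p.1.2 p.2.1 p.2.2
      = ∑ p ∈ quadruples n, h p.2.1 p.2.2 p.1.1 p.1.2 := by
  refine sum_nbij' (fun p => (p.2, p.1)) (fun p => (p.2, p.1)) ?_ ?_ ?_ ?_ ?_
  · intro p hp
    rw [mem_quadruples] at hp ⊢
    simp only [mul_comm p.2.1, mul_comm p.2.2]
    tauto
  · intro p hp
    rw [mem_quadruples] at hp ⊢
    simp only [mul_comm p.2.1, mul_comm p.2.2]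
    tauto
  all_goals simp

theorem sum_quadruples_lt_eq_sum_gt (n : ℕ) (h : ℕ → ℕ → ℕ → ℕ → ℚ) :
    ∑ p ∈ (quadruples n).filter (fun p => p.2.1 < p.2.2), h p.1.1 p.1.2 p.2.1 p.2.2
      = ∑ p ∈ (quadruples n).filter (fun p => p.2.2 < p.2.1), h p.1.2 p.1.1 p.2.2 p.2.1 := by
  refine sum_nbij' (fun p => (p.1.swap, p.2.swap)) (fun p => (p.1.swap, p.2.swap))
    ?_ ?_ ?_ ?_ ?_
  · intro p hp
    rw [mem_filter, mem_quadruples] at hp ⊢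
    simp only [Prod.fst_swap, Prod.snd_swap]
    rw [add_comm]
    tauto
  · intro p hp
    rw [mem_filter, mem_quadruples] at hp ⊢
    simp only [Prod.fst_swap, Prod.snd_swap]
    rw [add_comm]
    tauto
  all_goals simp

theorem sum_quadruples_eq_gt_add_diag (n : ℕ) (h : ℕ → ℕ → ℕ → ℕ → ℚ) :
    ∑ p ∈ quadruples n, h p.1.1 p.1.2 p.2.1 p.2.2
      = ∑ p ∈ (quadruples n).filter (fun p => p.2.2 < p.2.1),
          (h p.1.1 p.1.2 p.2.1 p.2.2 + h p.1.2 p.1.1 p.2.2 p.2.1)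
        + ∑ p ∈ (quadruples n).filter (fun p => p.2.1 = p.2.2),
          h p.1.1 p.1.2 p.2.1 p.2.2 := by
  rw [sum_add_distrib, ← sum_quadruples_lt_eq_sum_gt, sum_filter, sum_filter, sum_filter,
    ← sum_add_distrib, ← sum_add_distrib]
  refine sum_congr rfl fun p _ => ?_
  rcases lt_trichotomy p.2.1 p.2.2 with hp | hp | hp
  · simp [hp, hp.not_gt, hp.ne]
  · simp [hp]
  · simp [hp, hp.not_gt, hp.ne']

theorem sum_quadruples_gt_involution (n : ℕ) (h : ℕ → ℕ → ℕ → ℕ → ℚ) :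
    ∑ p ∈ (quadruples n).filter (fun p => p.2.2 < p.2.1), h p.1.1 p.1.2 p.2.1 p.2.2
      = ∑ p ∈ (quadruples n).filter (fun p => p.2.2 < p.2.1),
          h p.2.2 (p.2.1 - p.2.2) (p.1.1 + p.1.2) p.1.1 := by
  have key : ∀ p ∈ (quadruples n).filter (fun p => p.2.2 < p.2.1),
      ((p.2.2, p.2.1 - p.2.2), (p.1.1 + p.1.2, p.1.1))
        ∈ (quadruples n).filter (fun p => p.2.2 < p.2.1) := by
    rintro ⟨⟨a, b⟩, x, y⟩ hp
    rw [mem_filter, mem_quadruples] at hp ⊢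
    obtain ⟨⟨ha, hb, hx, hy, h⟩, hlt⟩ := hp
    dsimp only at *
    obtain ⟨z, rfl⟩ := Nat.exists_eq_add_of_lt hlt
    have hz : y + z + 1 - y = z + 1 := by omega
    rw [hz]
    refine ⟨⟨hy, by omega, by omega, ha, ?_⟩, by omega⟩
    rw [← h]
    ring
  have inv : ∀ p ∈ (quadruples n).filter (fun p => p.2.2 < p.2.1),
      ((p.1.1, p.1.1 + p.1.2 - p.1.1), (p.2.2 + (p.2.1 - p.2.2), p.2.2)) = p := by
    rintro ⟨⟨a, b⟩, x, y⟩ hp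
    have hlt := (mem_filter.1 hp).2
    dsimp only at *
    rw [Nat.add_sub_cancel_left, Nat.add_sub_cancel' hlt.le]
  refine sum_nbij' (fun p => ((p.2.2, p.2.1 - p.2.2), (p.1.1 + p.1.2, p.1.1)))
    (fun p => ((p.2.2, p.2.1 - p.2.2), (p.1.1 + p.1.2, p.1.1))) key key inv inv ?_
  intro p hp
  have := inv p hp
  simp only [Prod.ext_iff] at this
  simp only [this]

theorem sum_quadruples_diag (n : ℕ) (h : ℕ → ℕ → ℕ → ℕ → ℚ) :
    ∑ p ∈ (quadruples n).filter (fun p => p.2.1 = p.2.2), h p.1.1 p.1.2 p.2.1 p.2.2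
      = ∑ d ∈ n.divisors, ∑ a ∈ Ico 1 d, h a (d - a) (n / d) (n / d) := by
  rw [sum_sigma']
  refine sum_bij' (fun p _ => (⟨p.1.1 + p.1.2, p.1.1⟩ : Σ _ : ℕ, ℕ))
    (fun s _ => ((s.2, s.1 - s.2), (n / s.1, n / s.1))) ?_ ?_ ?_ ?_ ?_
  · rintro ⟨⟨a, b⟩, x, y⟩ hp
    rw [mem_filter, mem_quadruples] at hp
    obtain ⟨⟨ha, hb, hx, hy, h⟩, hxy⟩ := hp
    dsimp only at *
    subst hxy
    rw [mem_sigma, Nat.mem_divisors, mem_Ico]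
    dsimp only
    rw [← add_mul] at h
    exact ⟨⟨⟨x, h.symm⟩, by rw [← h]; positivity⟩, ha, by omega⟩
  · rintro ⟨d, a⟩ hs
    rw [mem_sigma, Nat.mem_divisors, mem_Ico] at hs
    obtain ⟨⟨hd, hn⟩, ha, had⟩ := hs
    rw [mem_filter, mem_quadruples]
    dsimp only at *
    have hq : 0 < n / d := Nat.div_pos (Nat.le_of_dvd (Nat.pos_of_ne_zero hn) hd) (by omega)
    refine ⟨⟨ha, by omega, hq, hq, ?_⟩, rfl⟩
    rw [← add_mul, Nat.add_sub_cancel' had.le, Nat.mul_div_cancel' hd]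
  · rintro ⟨⟨a, b⟩, x, y⟩ hp
    rw [mem_filter, mem_quadruples] at hp
    obtain ⟨⟨ha, hb, hx, hy, h⟩, hxy⟩ := hp
    dsimp only at *
    subst hxy
    rw [← add_mul] at h
    rw [Nat.add_sub_cancel_left, ← h, Nat.mul_div_cancel_left _ (by omega)]
  · rintro ⟨d, a⟩ hs
    rw [mem_sigma, mem_Ico] at hs
    dsimp only at *
    rw [Nat.add_sub_cancel' hs.2.2.le]
  · rintro ⟨⟨a, b⟩, x, y⟩ hp
    rw [mem_filter, mem_quadruples] at hp
    obtain ⟨⟨ha, hb, hx, hy, h⟩, hxy⟩ := hp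
    dsimp only at *
    subst hxy
    rw [← add_mul] at h
    rw [Nat.add_sub_cancel_left, ← h, Nat.mul_div_cancel_left _ (by omega)]

theorem sum_Ico_one_sq (d : ℕ) (hd : 0 < d) :
    ∑ a ∈ Ico 1 d, (a : ℚ) ^ 2 = ((d : ℚ) - 1) * d * (2 * d - 1) / 6 := by
  induction d, hd using Nat.le_induction with
  | base => simp
  | succ d hd ih =>
    rw [sum_Ico_succ_top hd, ih]
    push_cast
    ring

theorem sum_Ico_one_id (d : ℕ) (hd : 0 < d) :
    ∑ a ∈ Ico 1 d, (a : ℚ) = ((d : ℚ) - 1) * d / 2 := by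
  induction d, hd using Nat.le_induction with
  | base => simp
  | succ d hd ih =>
    rw [sum_Ico_succ_top hd, ih]
    push_cast
    ring

theorem sum_Ico_one_mul_sub (d : ℕ) (hd : 0 < d) :
    ∑ a ∈ Ico 1 d, (a : ℚ) * ((d - a : ℕ) : ℚ) = ((d : ℚ) ^ 3 - d) / 6 := by
  have : ∀ a ∈ Ico 1 d, (a : ℚ) * ((d - a : ℕ) : ℚ) = d * a - (a : ℚ) ^ 2 := by
    intro a ha
    rw [Nat.cast_sub (mem_Ico.1 ha).2.le]
    ring
  rw [sum_congr rfl this, sum_sub_distrib, ← mul_sum, sum_Ico_one_sq d hd, sum_Ico_one_id d hd]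
  ring

/-- The sums of `a * b` over the quadruples with `y < x` and over all quadruples, in terms of
divisor sums. -/
theorem sum_quadruples_mul (n : ℕ) :
    ∑ p ∈ (quadruples n).filter (fun p => p.2.2 < p.2.1), (p.1.1 : ℚ) * p.1.2
        = (sigmaPow 3 n + sigmaPow 1 n) / 8 - n * sigmaPow 1 n / 4 ∧
      ∑ p ∈ quadruples n, (p.1.1 : ℚ) * p.1.2
        = (5 * sigmaPow 3 n + sigmaPow 1 n) / 12 - n * sigmaPow 1 n / 2 := by
  have i1 := sum_quadruples_gt_involution n fun a _ _ _ => (a : ℚ) ^ 2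
  have i2 := sum_quadruples_gt_involution n fun _ _ x _ => (x : ℚ) ^ 2
  have i3 := sum_quadruples_gt_involution n fun _ _ x y => (x : ℚ) * y
  have t1 := sum_quadruples_eq_gt_add_diag n fun a b _ _ => (a : ℚ) * b
  have t2 := sum_quadruples_eq_gt_add_diag n fun _ _ x y => (x : ℚ) * y
  have t3 := sum_quadruples_eq_gt_add_diag n fun a _ _ _ => (a : ℚ) ^ 2
  have t4 := sum_quadruples_eq_gt_add_diag n fun _ _ x _ => (x : ℚ) ^ 2
  have u1 := sum_quadruples_dual n fun a b _ _ => (a : ℚ) * b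
  have u2 := sum_quadruples_dual n fun a _ _ _ => (a : ℚ) ^ 2
  have d1 := sum_quadruples_diag n fun a b _ _ => (a : ℚ) * b
  have d2 := sum_quadruples_diag n fun _ _ x y => (x : ℚ) * y
  have d3 := sum_quadruples_diag n fun a _ _ _ => (a : ℚ) ^ 2
  have d4 := sum_quadruples_diag n fun _ _ x _ => (x : ℚ) ^ 2
  have s1 : (sigmaPow 1 n : ℚ) = ∑ d ∈ n.divisors, (d : ℚ) := by simp [sigmaPow]
  have s2 : (sigmaPow 2 n : ℚ) = ∑ d ∈ n.divisors, (d : ℚ) ^ 2 := by simp [sigmaPow]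
  have s3 : (sigmaPow 3 n : ℚ) = ∑ d ∈ n.divisors, (d : ℚ) ^ 3 := by simp [sigmaPow]
  have e1 : ∑ d ∈ n.divisors, ∑ a ∈ Ico 1 d, (a : ℚ) * ((d - a : ℕ) : ℚ)
      = (sigmaPow 3 n - sigmaPow 1 n) / 6 := by
    rw [s1, s3, ← sum_sub_distrib, sum_div]
    exact sum_congr rfl fun d hd => sum_Ico_one_mul_sub d (Nat.pos_of_mem_divisors hd)
  have e3 : ∑ d ∈ n.divisors, ∑ a ∈ Ico 1 d, (a : ℚ) ^ 2
      = (2 * sigmaPow 3 n - 3 * sigmaPow 2 n + sigmaPow 1 n) / 6 := by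
    rw [s1, s2, s3, mul_sum, mul_sum, ← sum_sub_distrib, ← sum_add_distrib, sum_div]
    refine sum_congr rfl fun d hd => ?_
    rw [sum_Ico_one_sq d (Nat.pos_of_mem_divisors hd)]
    ring
  have e4 : ∑ d ∈ n.divisors, ∑ a ∈ Ico 1 d, ((n / d : ℕ) : ℚ) ^ 2
      = n * sigmaPow 1 n - sigmaPow 2 n := by
    have r1 : ∑ d ∈ n.divisors, ((n / d : ℕ) : ℚ) = sigmaPow 1 n := by
      rw [s1]
      exact Nat.sum_div_divisors n fun d => (d : ℚ)
    have r2 : ∑ d ∈ n.divisors, ((n / d : ℕ) : ℚ) ^ 2 = sigmaPow 2 n := by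
      rw [s2]
      exact Nat.sum_div_divisors n fun d => (d : ℚ) ^ 2
    rw [← r1, ← r2, mul_sum, ← sum_sub_distrib]
    refine sum_congr rfl fun d hd => ?_
    have hd0 := Nat.pos_of_mem_divisors hd
    have hn : (d : ℚ) * ((n / d : ℕ) : ℚ) = n := by
      exact_mod_cast Nat.mul_div_cancel' (Nat.dvd_of_mem_divisors hd)
    rw [sum_const, Nat.card_Ico, nsmul_eq_mul, Nat.cast_sub hd0, ← hn]
    push_cast
    ring
  simp only [← pow_two] at d2
  rw [e1] at d1
  rw [e3] at d3
  rw [e4] at d2 d4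
  rw [d1, u1] at t1
  rw [d2] at t2
  rw [d3, u2] at t3
  rw [d4] at t4
  rw [t2] at t1 u1
  rw [t4] at t3
  have c1 : ∀ p : (ℕ × ℕ) × (ℕ × ℕ),
      ((p.1.1 + p.1.2 : ℕ) : ℚ) ^ 2
        = (p.1.1 : ℚ) ^ 2 + (p.1.2 : ℚ) ^ 2 + 2 * ((p.1.1 : ℚ) * p.1.2) := by
    intro p
    push_cast
    ring
  have c2 : ∀ p : (ℕ × ℕ) × (ℕ × ℕ),
      ((p.1.1 + p.1.2 : ℕ) : ℚ) * p.1.1 = (p.1.1 : ℚ) ^ 2 + (p.1.1 : ℚ) * p.1.2 := by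
    intro p
    push_cast
    ring
  have c3 : ∀ p : (ℕ × ℕ) × (ℕ × ℕ), (p.1.2 : ℚ) * p.1.1 = (p.1.1 : ℚ) * p.1.2 :=
    fun p => mul_comm _ _
  have c4 : ∀ p : (ℕ × ℕ) × (ℕ × ℕ), (p.2.2 : ℚ) * p.2.1 = (p.2.1 : ℚ) * p.2.2 :=
    fun p => mul_comm _ _
  simp only [c1, c2, c3, c4, sum_add_distrib, ← mul_sum] at i1 i2 i3 t1 t2 t3 t4 u1
  constructor <;> linarith

theorem sigmaPow2_one_one (n : ℕ) :
    (sigmaPow2 1 1 n : ℚ) = (sigmaPow 3 n + sigmaPow 1 n) / 8 - n * sigmaPow 1 n / 4 := by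
  rw [← (sum_quadruples_mul n).1]
  have h := sum_quadruples_lt_eq_sum_gt n fun a b _ _ => (b : ℚ) * a
  rw [← h, sigmaPow2, quadruples, filter_filter]
  push_cast
  exact sum_congr rfl fun p _ => by ring

theorem sum_quadruples_mul_eq_convolution (n : ℕ) :
    ∑ p ∈ quadruples n, (p.1.1 : ℚ) * p.1.2
      = ∑ ij ∈ antidiagonal n, (sigmaPow 1 ij.1 : ℚ) * sigmaPow 1 ij.2 := by
  have hs : ∀ m, (sigmaPow 1 m : ℚ) = ∑ c ∈ m.divisorsAntidiagonal, (c.1 : ℚ) := by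
    intro m
    rw [sigmaPow, Nat.cast_sum, Nat.sum_divisorsAntidiagonal (f := fun d _ => (d : ℚ))]
    simp
  simp only [hs, sum_mul_sum, ← sum_product']
  rw [sum_sigma']
  refine sum_bij' (fun p _ => (⟨(p.1.1 * p.2.1, p.1.2 * p.2.2), (p.1.1, p.2.1), (p.1.2, p.2.2)⟩ :
      Σ _ : ℕ × ℕ, (ℕ × ℕ) × (ℕ × ℕ)))
    (fun s _ => ((s.2.1.1, s.2.2.1), (s.2.1.2, s.2.2.2))) ?_ ?_ ?_ ?_ ?_
  · rintro ⟨⟨a, b⟩, x, y⟩ hp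
    rw [mem_quadruples] at hp
    obtain ⟨ha, hb, hx, hy, h⟩ := hp
    simp only [mem_sigma, HasAntidiagonal.mem_antidiagonal, mem_product,
      Nat.mem_divisorsAntidiagonal]
    dsimp only at *
    exact ⟨h, ⟨trivial, by positivity⟩, trivial, by positivity⟩
  · rintro ⟨⟨i, j⟩, ⟨a, x⟩, b, y⟩ hs
    simp only [mem_sigma, HasAntidiagonal.mem_antidiagonal, mem_product,
      Nat.mem_divisorsAntidiagonal] at hs
    obtain ⟨h, ⟨rfl, hi⟩, rfl, hj⟩ := hs
    rw [mem_quadruples]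
    exact ⟨Nat.pos_of_ne_zero (left_ne_zero_of_mul hi),
      Nat.pos_of_ne_zero (left_ne_zero_of_mul hj), Nat.pos_of_ne_zero (right_ne_zero_of_mul hi),
      Nat.pos_of_ne_zero (right_ne_zero_of_mul hj), h⟩
  · simp
  · rintro ⟨⟨i, j⟩, ⟨a, x⟩, b, y⟩ hs
    simp only [mem_sigma, HasAntidiagonal.mem_antidiagonal, mem_product,
      Nat.mem_divisorsAntidiagonal] at hs
    obtain ⟨h, ⟨rfl, hi⟩, rfl, hj⟩ := hs
    rfl
  · simp

/-- The Besge-Ramanujan convolution formula for `σ_1`. -/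
theorem sum_antidiagonal_sigmaPow_one (n : ℕ) :
    ∑ ij ∈ antidiagonal n, (sigmaPow 1 ij.1 : ℚ) * sigmaPow 1 ij.2
      = (5 * sigmaPow 3 n + sigmaPow 1 n) / 12 - n * sigmaPow 1 n / 2 := by
  rw [← sum_quadruples_mul_eq_convolution, (sum_quadruples_mul n).2]

/-- The generating series `∑_λ f(λ) X^|λ|` of a weight `f` on partitions. -/
def partitionSeries : (Multiset ℕ → ℚ) →ₗ[ℚ] PowerSeries ℚ where
  toFun f := PowerSeries.mk fun n => ∑ lam : n.Partition, f lam.parts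
  map_add' f g := by
    ext n
    simp [sum_add_distrib]
  map_smul' c f := by
    ext n
    simp [mul_sum]

theorem coeff_partitionSeries (f : Multiset ℕ → ℚ) (n : ℕ) :
    PowerSeries.coeff n (partitionSeries f) = ∑ lam : n.Partition, f lam.parts := by
  simp [partitionSeries]

theorem partitionSeries_congr {f g : Multiset ℕ → ℚ}
    (h : ∀ s : Multiset ℕ, (∀ x ∈ s, 0 < x) → f s = g s) :
    partitionSeries f = partitionSeries g := by
  ext n
  simp only [coeff_partitionSeries]
  exact sum_congr rfl fun lam _ => h _ fun _ => lam.parts_pos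

theorem partitionSeries_eq_X_pow_mul {j : ℕ} (hj : 0 < j) {f : Multiset ℕ → ℚ}
    (hf : ∀ s, j ∉ s → f s = 0) :
    partitionSeries f = PowerSeries.X ^ j * partitionSeries fun s => f (j ::ₘ s) := by
  ext n
  rw [PowerSeries.coeff_X_pow_mul', coeff_partitionSeries]
  split_ifs with hn
  · have h1 : ∑ lam : n.Partition, f lam.parts
        = ∑ lam ∈ univ.filter (fun lam : n.Partition => j ∈ lam.parts), f lam.parts := by
      rw [sum_filter]
      refine sum_congr rfl fun lam _ => ?_
      split_ifs with h
      · rfl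
      · exact hf _ h
    rw [h1, coeff_partitionSeries,
      sum_subtype (p := fun lam : n.Partition => j ∈ lam.parts) _ (by simp),
      ← Equiv.sum_comp (Nat.Partition.partitionWithPartEquiv hj hn).symm]
    simp only [Nat.Partition.partitionWithPartEquiv_symm_apply_parts]
  · exact sum_eq_zero fun lam _ => hf _ fun h => hn (Nat.Partition.le_of_mem_parts h)

/-- The Lambert series `X^j / (1 - X^j)`. -/
def lambert (j : ℕ) : PowerSeries ℚ :=
  PowerSeries.mk fun n => if 0 < n ∧ j ∣ n then 1 else 0

theorem lambert_eq {j : ℕ} (hj : 0 < j) :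
    lambert j = PowerSeries.X ^ j * (1 + lambert j) := by
  ext n
  rw [PowerSeries.coeff_X_pow_mul', lambert, map_add, PowerSeries.coeff_mk, PowerSeries.coeff_mk,
    PowerSeries.coeff_one]
  by_cases hjn : j ≤ n
  · obtain ⟨m, rfl⟩ := Nat.exists_eq_add_of_le hjn
    rcases Nat.eq_zero_or_pos m with rfl | hm
    · simp [hj]
    · simp [hj, hm, hm.ne']
  · rw [if_neg hjn, if_neg fun h => hjn (Nat.le_of_dvd h.1 h.2)]

theorem eq_mul_lambert {j : ℕ} (hj : 0 < j) {A B : PowerSeries ℚ}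
    (h : A = PowerSeries.X ^ j * (A + B)) : A = B * lambert j := by
  have h0 : (1 - PowerSeries.X ^ j : PowerSeries ℚ) ≠ 0 := by
    intro h
    have := congrArg PowerSeries.constantCoeff h
    simp [hj.ne'] at this
  refine mul_left_cancel₀ h0 ?_
  linear_combination h - B * lambert_eq hj

theorem partitionSeries_count {j : ℕ} (hj : 0 < j) :
    partitionSeries (fun s => (s.count j : ℚ)) = partitionSeries 1 * lambert j := by
  refine eq_mul_lambert hj ?_
  conv_lhs => rw [partitionSeries_eq_X_pow_mul hj (by simp)]
  rw [← map_add]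
  congr 2
  ext s
  simp

theorem partitionSeries_count_sq {j : ℕ} (hj : 0 < j) :
    partitionSeries (fun s => (s.count j : ℚ) ^ 2)
      = partitionSeries 1 * (2 * lambert j ^ 2 + lambert j) := by
  have h : partitionSeries (fun s => (s.count j : ℚ) ^ 2)
      = (2 * partitionSeries (fun s => (s.count j : ℚ)) + partitionSeries 1) * lambert j := by
    refine eq_mul_lambert hj ?_
    conv_lhs => rw [partitionSeries_eq_X_pow_mul hj (by simp)]
    rw [two_mul, ← map_add, ← map_add, ← map_add]
    congr 2
    ext s
    simp
    ring
  rw [h, partitionSeries_count hj]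
  ring

theorem partitionSeries_count_mul_count {i j : ℕ} (hi : 0 < i) (hj : 0 < j) (hij : i ≠ j) :
    partitionSeries (fun s => (s.count i : ℚ) * s.count j)
      = partitionSeries 1 * (lambert i * lambert j) := by
  have h : partitionSeries (fun s => (s.count i : ℚ) * s.count j)
      = partitionSeries (fun s => (s.count i : ℚ)) * lambert j := by
    refine eq_mul_lambert hj ?_
    conv_lhs => rw [partitionSeries_eq_X_pow_mul hj (by simp +contextual)]
    rw [← map_add]
    congr 2
    ext s
    simp [hij]
    ring
  rw [h, partitionSeries_count hi]
  ring

theorem partitionSeries_sum_count {S : Finset ℕ} (hS : ∀ j ∈ S, 0 < j) :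
    partitionSeries (fun s => ∑ j ∈ S, (s.count j : ℚ))
      = partitionSeries 1 * ∑ j ∈ S, lambert j := by
  have h : (fun s : Multiset ℕ => ∑ j ∈ S, (s.count j : ℚ))
      = ∑ j ∈ S, fun s => (s.count j : ℚ) := by
    ext s
    simp
  rw [h, map_sum, mul_sum]
  exact sum_congr rfl fun j hj => partitionSeries_count (hS j hj)

theorem partitionSeries_sum_count_sq {S : Finset ℕ} (hS : ∀ j ∈ S, 0 < j) :
    partitionSeries (fun s => (∑ j ∈ S, (s.count j : ℚ)) ^ 2)
      = partitionSeries 1 *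
        ((∑ j ∈ S, lambert j) ^ 2 + ∑ j ∈ S, (lambert j ^ 2 + lambert j)) := by
  have h : (fun s : Multiset ℕ => (∑ j ∈ S, (s.count j : ℚ)) ^ 2)
      = ∑ i ∈ S, ∑ j ∈ S, fun s => (s.count i : ℚ) * s.count j := by
    ext s
    simp [sq, sum_mul_sum]
  rw [h, map_sum, sq, sum_mul_sum, ← sum_add_distrib, mul_sum]
  refine sum_congr rfl fun i hi => ?_
  rw [map_sum]
  have h2 : ∀ j ∈ S, partitionSeries (fun s => (s.count i : ℚ) * s.count j)
      = partitionSeries 1 *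
        (lambert i * lambert j + if i = j then lambert i ^ 2 + lambert i else 0) := by
    intro j hj
    split_ifs with hij
    · subst hij
      simp only [← sq]
      rw [partitionSeries_count_sq (hS i hi)]
      ring
    · rw [partitionSeries_count_mul_count (hS i hi) (hS j hj) hij, add_zero]
  rw [sum_congr rfl h2, ← mul_sum, sum_add_distrib, sum_ite_eq, if_pos hi]

/-- The factor by which `partitionSeries 1` is multiplied to give the generating series of the
squared difference between `w` and the number of parts exceeding `w` and at most `N`. -/
noncomputable def shiftedSquareFactor (N w : ℕ) : PowerSeries ℚ :=
  (∑ j ∈ Ioc w N, lambert j) ^ 2 + ∑ j ∈ Ioc w N, (lambert j ^ 2 + lambert j)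
    - 2 * w * ∑ j ∈ Ioc w N, lambert j + w ^ 2

theorem partitionSeries_shifted_sq (N w : ℕ) :
    partitionSeries (fun s => (∑ j ∈ Ioc w N, (s.count j : ℚ) - w) ^ 2)
      = partitionSeries 1 * shiftedSquareFactor N w := by
  have hS : ∀ j ∈ Ioc w N, 0 < j := fun j hj => by
    have := (mem_Ioc.1 hj).1
    omega
  have h : (fun s : Multiset ℕ => (∑ j ∈ Ioc w N, (s.count j : ℚ) - w) ^ 2)
      = (fun s => (∑ j ∈ Ioc w N, (s.count j : ℚ)) ^ 2)
        - (2 * w : ℚ) • (fun s => ∑ j ∈ Ioc w N, (s.count j : ℚ)) + ((w : ℚ) ^ 2) • 1 := by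
    ext s
    simp
    ring
  rw [h, map_add, map_sub, map_smul, map_smul, partitionSeries_sum_count_sq hS,
    partitionSeries_sum_count hS, shiftedSquareFactor, PowerSeries.smul_eq_C_mul,
    PowerSeries.smul_eq_C_mul]
  simp only [map_mul, map_pow, map_natCast, map_ofNat]
  ring

theorem sum_range_succ_X_pow_mul_shiftedSquareFactor (N M : ℕ) (hM : M ≤ N) :
    (1 - PowerSeries.X) * ∑ w ∈ range (M + 1), PowerSeries.X ^ w * shiftedSquareFactor N w
        + PowerSeries.X ^ (M + 1) * shiftedSquareFactor N M
      = 2 * ∑ w ∈ Ioc 0 M, (w : PowerSeries ℚ) * lambert w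
        + ((∑ j ∈ Ioc M N, lambert j) ^ 2 + ∑ j ∈ Ioc M N, (lambert j ^ 2 + lambert j)) := by
  induction M with
  | zero =>
    simp [shiftedSquareFactor]
    ring
  | succ M ih =>
    have hsplit : ∀ f : ℕ → PowerSeries ℚ,
        ∑ j ∈ Ioc M N, f j = f (M + 1) + ∑ j ∈ Ioc (M + 1) N, f j := by
      intro f
      rw [← Finset.insert_Ioc_add_one_left_eq_Ioc hM, sum_insert (by simp)]
    have ih := ih (by omega)
    have ht := lambert_eq (Nat.succ_pos M)
    rw [sum_range_succ, sum_Ioc_succ_top (Nat.zero_le M)]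
    simp only [shiftedSquareFactor, hsplit] at ih ⊢
    push_cast at ih ⊢
    simp only [Nat.succ_eq_add_one] at ht
    linear_combination ih + (2 * ∑ j ∈ Ioc (M + 1) N, lambert j + 2 * lambert (M + 1)
      + 1 - 2 * (M + 1)) * ht

theorem sum_X_pow_mul_shiftedSquareFactor (N : ℕ) :
    (1 - PowerSeries.X) * ∑ w ∈ range (N + 1), PowerSeries.X ^ w * shiftedSquareFactor N w
      = 2 * ∑ w ∈ Ioc 0 N, (w : PowerSeries ℚ) * lambert w
        - PowerSeries.X ^ (N + 1) * shiftedSquareFactor N N := by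
  have h := sum_range_succ_X_pow_mul_shiftedSquareFactor N N le_rfl
  simp only [Ioc_self, sum_empty] at h
  linear_combination h

theorem partitionSeries_count_one_eq {h : Multiset ℕ → ℚ} (hh : ∀ s, h (1 ::ₘ s) = h s) (w : ℕ) :
    partitionSeries (fun s => if s.count 1 = w then h s else 0)
      = PowerSeries.X ^ w * ((1 - PowerSeries.X) * partitionSeries h) := by
  induction w with
  | zero =>
    have h1 : partitionSeries (fun s => if s.count 1 = 0 then 0 else h s)
        = PowerSeries.X * partitionSeries h := by
      rw [partitionSeries_eq_X_pow_mul one_pos (by simp +contextual)]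
      simp [hh]
    have h2 : partitionSeries h = partitionSeries (fun s => if s.count 1 = 0 then h s else 0)
        + partitionSeries (fun s => if s.count 1 = 0 then 0 else h s) := by
      rw [← map_add]
      congr 1
      ext s
      simp only [Pi.add_apply]
      split_ifs <;> simp
    linear_combination -h2 - h1
  | succ w ih =>
    rw [partitionSeries_eq_X_pow_mul one_pos (by simp +contextual)]
    simp only [Multiset.count_cons_self, hh, add_left_inj, ih]
    ring

theorem partitionSeries_sup_sq_no_ones :
    partitionSeries (fun s => if s.count 1 = 0 then (s.sup : ℚ) ^ 2 else 0)
      = (1 - PowerSeries.X) * partitionSeries (fun s => (s.sup : ℚ) ^ 2) - PowerSeries.X := by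
  have h0 : partitionSeries (fun s => if s = 0 then 1 else 0) = 1 := by
    ext n
    rw [coeff_partitionSeries, PowerSeries.coeff_one]
    split_ifs with hn
    · subst hn
      simp
    · refine sum_eq_zero fun lam _ => if_neg fun h => hn ?_
      rw [← lam.parts_sum, h, Multiset.sum_zero]
  have h1 : partitionSeries (fun s => if s.count 1 = 0 then 0 else (s.sup : ℚ) ^ 2)
      = PowerSeries.X * (partitionSeries (fun s => (s.sup : ℚ) ^ 2) + 1) := by
    rw [← h0, partitionSeries_eq_X_pow_mul one_pos (by simp +contextual), pow_one, ← map_add]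
    congr 1
    refine partitionSeries_congr fun s hs => ?_
    rcases eq_or_ne s 0 with rfl | h
    · simp
    · obtain ⟨x, hx⟩ := Multiset.exists_mem_of_ne_zero h
      have : 1 ≤ s.sup := (hs x hx).trans_le (Multiset.le_sup hx)
      simp [h, this]
  have h2 : partitionSeries (fun s => (s.sup : ℚ) ^ 2)
      = partitionSeries (fun s => if s.count 1 = 0 then (s.sup : ℚ) ^ 2 else 0)
        + partitionSeries (fun s => if s.count 1 = 0 then 0 else (s.sup : ℚ) ^ 2) := by
    rw [← map_add]
    congr 1
    ext s
    simp only [Pi.add_apply]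
    split_ifs <;> simp
  linear_combination -h2 - h1

/-- The conjugate of a partition, as a multiset of parts. -/
def conjugateParts (s : Multiset ℕ) : Multiset ℕ :=
  (Multiset.range s.sup).map fun i => (s.filter (i < ·)).card

theorem card_conjugateParts (s : Multiset ℕ) : (conjugateParts s).card = s.sup := by
  simp [conjugateParts]

theorem card_filter_lt_pos {s : Multiset ℕ} {i : ℕ} (hi : i < s.sup) :
    0 < (s.filter (i < ·)).card := by
  rw [Multiset.card_pos_iff_exists_mem]
  by_contra! h
  refine hi.not_ge (Multiset.sup_le.2 fun x hx => ?_)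
  by_contra! hx'
  exact h x (Multiset.mem_filter.2 ⟨hx, hx'⟩)

theorem sum_conjugateParts (s : Multiset ℕ) : (conjugateParts s).sum = s.sum := by
  have key : ∀ (N : ℕ) (s : Multiset ℕ), (∀ x ∈ s, x ≤ N) →
      ∑ i ∈ range N, (s.filter (i < ·)).card = s.sum := by
    intro N s
    induction s using Multiset.induction_on with
    | empty => simp
    | cons a s ih =>
      intro h
      have ha : a ≤ N := h a (Multiset.mem_cons_self a s)
      have hcard : ∀ i, ((a ::ₘ s).filter (i < ·)).card
          = (if i < a then 1 else 0) + (s.filter (i < ·)).card := by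
        intro i
        split_ifs with hi <;> simp [hi, add_comm]
      rw [sum_congr rfl fun i _ => hcard i, sum_add_distrib,
        ih fun x hx => h x (Multiset.mem_cons_of_mem hx), Multiset.sum_cons, ← sum_filter,
        sum_const, smul_eq_mul, mul_one]
      congr 1
      rw [show (range N).filter (· < a) = range a by
        ext x
        simp only [mem_filter, mem_range]
        omega, card_range]
  exact key s.sup s fun x hx => Multiset.le_sup hx

theorem conjugateParts_injective {s t : Multiset ℕ} (hs : ∀ x ∈ s, 0 < x) (ht : ∀ x ∈ t, 0 < x)
    (h : conjugateParts s = conjugateParts t) : s = t := by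
  have hsup : s.sup = t.sup := by rw [← card_conjugateParts, h, card_conjugateParts]
  have hzero : ∀ (u : Multiset ℕ) (i : ℕ), u.sup ≤ i → (u.filter (i < ·)).card = 0 := by
    intro u i hi
    rw [Multiset.card_eq_zero, Multiset.filter_eq_nil]
    exact fun x hx => ((Multiset.le_sup hx).trans hi).not_gt
  have hanti : ∀ u : Multiset ℕ,
      ((List.range u.sup).map fun i => (u.filter (i < ·)).card).Pairwise (· ≥ ·) := by
    intro u
    rw [List.pairwise_map]
    refine List.pairwise_lt_range.imp fun hab => Multiset.card_le_card ?_
    exact Multiset.monotone_filter_right u fun x hx => hab.trans hx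
  have hperm : ((List.range s.sup).map fun i => (s.filter (i < ·)).card).Perm
      ((List.range t.sup).map fun i => (t.filter (i < ·)).card) := by
    rw [← Multiset.coe_eq_coe]
    exact h
  have hlist := hperm.eq_of_pairwise (fun a b _ _ h1 h2 => le_antisymm h2 h1) (hanti s) (hanti t)
  have hcard : ∀ i, (s.filter (i < ·)).card = (t.filter (i < ·)).card := by
    intro i
    by_cases hi : i < s.sup
    · rw [hsup, List.map_inj_left] at hlist
      exact hlist i (List.mem_range.2 (hsup ▸ hi))
    · rw [hzero s i (not_lt.1 hi), hzero t i (hsup ▸ not_lt.1 hi)]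
  have hcount : ∀ (u : Multiset ℕ) (x : ℕ),
      (u.filter (x < ·)).card = u.count (x + 1) + (u.filter (x + 1 < ·)).card := by
    intro u x
    induction u using Multiset.induction_on with
    | empty => simp
    | cons a u ih =>
      rcases lt_trichotomy a (x + 1) with ha | rfl | ha
      · simp [ih, ha.ne', show ¬ x < a by omega, show ¬ x + 1 < a by omega]
      · simp [ih]
        omega
      · simp [ih, ha.ne, ha, show x < a by omega]
        omega
  ext x
  rcases x with _ | x
  · rw [Multiset.count_eq_zero.2 fun h => (hs 0 h).false,
      Multiset.count_eq_zero.2 fun h => (ht 0 h).false]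
  · have h1 := hcount s x
    have h2 := hcount t x
    have h3 := hcard x
    have h4 := hcard (x + 1)
    omega

theorem sum_sup_sq_eq_sum_card_sq (n : ℕ) :
    ∑ lam : n.Partition, (lam.parts.sup : ℚ) ^ 2
      = ∑ lam : n.Partition, (lam.parts.card : ℚ) ^ 2 := by
  let e : n.Partition → n.Partition := fun lam =>
    { parts := conjugateParts lam.parts
      parts_pos := by
        intro i hi
        obtain ⟨j, hj, rfl⟩ := Multiset.mem_map.1 hi
        exact card_filter_lt_pos (Multiset.mem_range.1 hj)
      parts_sum := (sum_conjugateParts _).trans lam.parts_sum }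
  have he : Function.Injective e := fun lam mu h => Nat.Partition.ext <|
    conjugateParts_injective (fun _ => lam.parts_pos) (fun _ => mu.parts_pos)
      (congrArg Nat.Partition.parts h)
  symm
  rw [← (Finite.injective_iff_bijective.1 he).sum_comp]
  exact sum_congr rfl fun lam _ => by simp [e, card_conjugateParts]

theorem card_filter_lt_eq_sum_count {s : Multiset ℕ} {N : ℕ} (hs : ∀ x ∈ s, x ≤ N) (w : ℕ) :
    ((s.filter (w < ·)).card : ℚ) = ∑ j ∈ Ioc w N, (s.count j : ℚ) := by
  rw [← Nat.cast_sum, ← Multiset.sum_count_eq_card (s := Ioc w N)]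
  · refine congrArg _ (sum_congr rfl fun j hj => ?_)
    rw [Multiset.count_filter_of_pos (mem_Ioc.1 hj).1]
  · intro x hx
    rw [Multiset.mem_filter] at hx
    exact mem_Ioc.2 ⟨hx.2, hs x hx.1⟩

theorem sum_sup_sq_eq_coeff {m N : ℕ} (h : m ≤ N) :
    PowerSeries.coeff m (partitionSeries fun s => (s.sup : ℚ) ^ 2)
      = PowerSeries.coeff m (partitionSeries 1 * shiftedSquareFactor N 0) := by
  rw [← partitionSeries_shifted_sq, coeff_partitionSeries, coeff_partitionSeries,
    sum_sup_sq_eq_sum_card_sq]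
  refine sum_congr rfl fun lam _ => ?_
  rw [← card_filter_lt_eq_sum_count fun x hx => (lam.le_of_mem_parts hx).trans h,
    Multiset.filter_eq_self.2 fun x hx => lam.parts_pos hx]
  simp

theorem sum_mul_count {n : ℕ} (lam : n.Partition) :
    ∑ j ∈ Ioc 0 n, (j : ℚ) * lam.parts.count j = n := by
  have h : lam.parts.sum = ∑ j ∈ Ioc 0 n, lam.parts.count j • j :=
    sum_multiset_count_of_subset _ _ fun x hx => by
      rw [Multiset.mem_toFinset] at hx
      exact mem_Ioc.2 ⟨lam.parts_pos hx, lam.le_of_mem_parts hx⟩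
  rw [lam.parts_sum] at h
  conv_rhs => rw [h]
  push_cast
  exact sum_congr rfl fun j _ => by simp [mul_comm]

theorem coeff_partitionSeries_one (n : ℕ) :
    PowerSeries.coeff n (partitionSeries 1) = partitionCount n := by
  simp [coeff_partitionSeries, partitionCount]

theorem coeff_partitionSeries_mul_sum_lambert (n : ℕ) :
    PowerSeries.coeff n
        (partitionSeries 1 * ∑ w ∈ Ioc 0 n, (w : PowerSeries ℚ) * lambert w)
      = n * partitionCount n := by
  have h : partitionSeries 1 * ∑ w ∈ Ioc 0 n, (w : PowerSeries ℚ) * lambert w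
      = partitionSeries (∑ w ∈ Ioc 0 n, (w : ℚ) • fun s => (s.count w : ℚ)) := by
    rw [map_sum, mul_sum]
    refine sum_congr rfl fun w hw => ?_
    rw [map_smul, partitionSeries_count (mem_Ioc.1 hw).1, PowerSeries.smul_eq_C_mul, map_natCast]
    ring
  rw [h, coeff_partitionSeries]
  simp only [Finset.sum_apply, Pi.smul_apply, smul_eq_mul, sum_mul_count]
  simp [partitionCount, mul_comm]

theorem crank_sq {n : ℕ} (lam : n.Partition) :
    (crank lam : ℚ) ^ 2
      = (if lam.parts.count 1 = 0 then (lam.parts.sup : ℚ) ^ 2 else 0)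
        + ∑ w ∈ Ioc 0 n, if lam.parts.count 1 = w then
            (∑ j ∈ Ioc w n, (lam.parts.count j : ℚ) - w) ^ 2 else 0 := by
  have hle : lam.parts.count 1 ≤ n := by
    calc lam.parts.count 1 ≤ lam.parts.card := Multiset.count_le_card _ _
      _ = (lam.parts.map fun _ => 1).sum := by simp
      _ ≤ (lam.parts.map id).sum := Multiset.sum_map_le_sum_map _ _ fun x hx => lam.parts_pos hx
      _ = n := by rw [Multiset.map_id, lam.parts_sum]
  rw [sum_ite_eq, crank]
  split_ifs with h1 h2 h2
  · simp [h1] at h2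
  · simp
  · rw [← card_filter_lt_eq_sum_count fun x hx => lam.le_of_mem_parts hx]
    simp
  · exact (h2 (mem_Ioc.2 ⟨Nat.pos_of_ne_zero h1, hle⟩)).elim

/-- Dyson's formula for the second crank moment. -/
theorem sum_crank_sq {n : ℕ} (hn : 2 ≤ n) :
    ∑ lam : n.Partition, (crank lam : ℚ) ^ 2 = 2 * n * partitionCount n := by
  have h : ∑ lam : n.Partition, (crank lam : ℚ) ^ 2
      = PowerSeries.coeff n
          (partitionSeries (fun s => if s.count 1 = 0 then (s.sup : ℚ) ^ 2 else 0)
            + ∑ w ∈ Ioc 0 n, partitionSeries fun s => if s.count 1 = w then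
              (∑ j ∈ Ioc w n, (s.count j : ℚ) - w) ^ 2 else 0) := by
    rw [map_add, map_sum]
    simp only [coeff_partitionSeries]
    rw [sum_comm, ← sum_add_distrib]
    exact sum_congr rfl fun lam _ => crank_sq lam
  have hw : ∀ w ∈ Ioc 0 n, partitionSeries (fun s => if s.count 1 = w then
      (∑ j ∈ Ioc w n, (s.count j : ℚ) - w) ^ 2 else 0)
        = partitionSeries 1 * ((1 - PowerSeries.X)
          * (PowerSeries.X ^ w * shiftedSquareFactor n w)) := by
    intro w hw
    rw [partitionSeries_count_one_eq _ w, partitionSeries_shifted_sq]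
    · ring
    · intro s
      congr 2
      refine sum_congr rfl fun j hj => ?_
      have := (mem_Ioc.1 hw).1
      have := (mem_Ioc.1 hj).1
      rw [Multiset.count_cons_of_ne (by omega)]
  have h0 : PowerSeries.coeff n
      (partitionSeries fun s => if s.count 1 = 0 then (s.sup : ℚ) ^ 2 else 0)
        = PowerSeries.coeff n (partitionSeries 1 * ((1 - PowerSeries.X)
          * (PowerSeries.X ^ 0 * shiftedSquareFactor n 0))) := by
    obtain ⟨m, rfl⟩ := Nat.exists_eq_add_of_le' (one_le_two.trans hn)
    rw [partitionSeries_sup_sq_no_ones, map_sub, PowerSeries.coeff_X, if_neg (by omega), sub_zero,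
      show partitionSeries 1 * ((1 - PowerSeries.X)
          * (PowerSeries.X ^ 0 * shiftedSquareFactor (m + 1) 0))
        = (1 - PowerSeries.X) * (partitionSeries 1 * shiftedSquareFactor (m + 1) 0) by ring,
      sub_mul, sub_mul, one_mul, one_mul, map_sub, map_sub, PowerSeries.coeff_succ_X_mul,
      PowerSeries.coeff_succ_X_mul, sum_sup_sq_eq_coeff le_rfl, sum_sup_sq_eq_coeff m.le_succ]
  have hrange : range (n + 1) = insert 0 (Ioc 0 n) := by
    ext x
    simp only [mem_range, mem_insert, mem_Ioc]
    omega
  have hsum : PowerSeries.X ^ 0 * shiftedSquareFactor n 0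
        + ∑ w ∈ Ioc 0 n, PowerSeries.X ^ w * shiftedSquareFactor n w
      = ∑ w ∈ range (n + 1), PowerSeries.X ^ w * shiftedSquareFactor n w := by
    rw [hrange, sum_insert (by simp)]
  rw [h, sum_congr rfl hw, map_add, h0, ← map_add, ← mul_sum, ← mul_sum, ← mul_add, ← mul_add,
    hsum, sum_X_pow_mul_shiftedSquareFactor, mul_sub, map_sub,
    mul_left_comm, mul_left_comm _ (PowerSeries.X ^ (n + 1)), PowerSeries.coeff_X_pow_mul',
    if_neg (by omega), sub_zero, ← map_ofNat PowerSeries.C 2, PowerSeries.coeff_C_mul,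
    coeff_partitionSeries_mul_sum_lambert]
  ring

theorem coeff_sum_lambert {m N : ℕ} (h : m ≤ N) :
    PowerSeries.coeff m (∑ w ∈ Ioc 0 N, (w : PowerSeries ℚ) * lambert w) = sigmaPow 1 m := by
  rw [map_sum, sigmaPow]
  have h1 : ∀ w ∈ Ioc 0 N, PowerSeries.coeff m ((w : PowerSeries ℚ) * lambert w)
      = if 0 < m ∧ w ∣ m then (w : ℚ) else 0 := by
    intro w _
    rw [← map_natCast PowerSeries.C, PowerSeries.coeff_C_mul, lambert, PowerSeries.coeff_mk]
    simp
  rw [sum_congr rfl h1, ← sum_filter]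
  push_cast
  simp only [pow_one]
  refine sum_congr ?_ fun _ _ => rfl
  ext w
  rw [mem_filter, mem_Ioc, Nat.mem_divisors]
  constructor
  · rintro ⟨_, h2, h3⟩
    exact ⟨h3, h2.ne'⟩
  · rintro ⟨h2, h3⟩
    have hm := Nat.pos_of_ne_zero h3
    exact ⟨⟨Nat.pos_of_dvd_of_pos h2 hm, (Nat.le_of_dvd hm h2).trans h⟩, hm, h2⟩

/-- The generating series of `σ_1`. -/
def sigmaSeries : PowerSeries ℚ := PowerSeries.mk fun n => (sigmaPow 1 n : ℚ)

theorem coeff_X_mul_derivative (f : PowerSeries ℚ) (n : ℕ) :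
    PowerSeries.coeff n (PowerSeries.X * PowerSeries.derivative ℚ f)
      = n * PowerSeries.coeff n f := by
  cases n with
  | zero => simp
  | succ n =>
    rw [PowerSeries.coeff_succ_X_mul, PowerSeries.coeff_derivative]
    push_cast
    ring

theorem X_mul_derivative_partitionSeries :
    PowerSeries.X * PowerSeries.derivative ℚ (partitionSeries 1)
      = partitionSeries 1 * sigmaSeries := by
  ext n
  rw [coeff_X_mul_derivative, coeff_partitionSeries_one,
    ← coeff_partitionSeries_mul_sum_lambert, PowerSeries.coeff_mul, PowerSeries.coeff_mul]
  refine sum_congr rfl fun p hp => ?_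
  have hp := HasAntidiagonal.mem_antidiagonal.1 hp
  rw [coeff_sum_lambert (show p.2 ≤ n by omega), sigmaSeries, PowerSeries.coeff_mk]

theorem sq_mul_partitionCount (n : ℕ) :
    2 * (n : ℚ) ^ 2 * partitionCount n
      = PowerSeries.coeff n (partitionSeries 1 *
          (2 * (sigmaSeries * sigmaSeries
            + PowerSeries.X * PowerSeries.derivative ℚ sigmaSeries))) := by
  have h : partitionSeries 1 * (2 * (sigmaSeries * sigmaSeries
        + PowerSeries.X * PowerSeries.derivative ℚ sigmaSeries))
      = PowerSeries.C 2 * (PowerSeries.X * PowerSeries.derivative ℚ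
          (PowerSeries.X * PowerSeries.derivative ℚ (partitionSeries 1))) := by
    rw [X_mul_derivative_partitionSeries, Derivation.leibniz, smul_eq_mul, smul_eq_mul,
      map_ofNat PowerSeries.C]
    linear_combination -2 * sigmaSeries * X_mul_derivative_partitionSeries
  rw [h, PowerSeries.coeff_C_mul, coeff_X_mul_derivative, coeff_X_mul_derivative,
    coeff_partitionSeries_one]
  ring

theorem coeff_sigmaSeries_combination (m : ℕ) :
    PowerSeries.coeff m (2 * (sigmaSeries * sigmaSeries
        + PowerSeries.X * PowerSeries.derivative ℚ sigmaSeries))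
      = -(1 / 3 : ℚ) * (12 * (sigmaPow2 1 1 m : ℚ) - 4 * (sigmaPow 3 m : ℚ)
          - 2 * (sigmaPow 1 m : ℚ)) := by
  rw [← map_ofNat PowerSeries.C 2, PowerSeries.coeff_C_mul, map_add, PowerSeries.coeff_mul,
    coeff_X_mul_derivative]
  simp only [sigmaSeries, PowerSeries.coeff_mk]
  rw [sum_antidiagonal_sigmaPow_one, sigmaPow2_one_one]
  ring

theorem derivative_of_second_crank_moment (n : ℕ) (hn : 2 ≤ n) :
    (n : ℚ) * ∑ lam : Nat.Partition n, (crank lam : ℚ) ^ 2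
      = -(1 / 3 : ℚ) * ∑ a ∈ Finset.range n, (partitionCount a : ℚ)
          * (12 * (sigmaPow2 1 1 (n - a) : ℚ) - 4 * (sigmaPow 3 (n - a) : ℚ)
            - 2 * (sigmaPow 1 (n - a) : ℚ)) := by
  rw [sum_crank_sq hn, show (n : ℚ) * (2 * n * partitionCount n)
    = 2 * (n : ℚ) ^ 2 * partitionCount n by ring, sq_mul_partitionCount, PowerSeries.coeff_mul,
    Nat.sum_antidiagonal_eq_sum_range_succ_mk, sum_range_succ, mul_sum]
  simp only [coeff_sigmaSeries_combination, coeff_partitionSeries_one]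
  rw [Nat.sub_self, show sigmaPow2 1 1 0 = 0 by simp [sigmaPow2],
    show ∀ k, sigmaPow k 0 = 0 by simp [sigmaPow], show ∀ k, sigmaPow k 0 = 0 by simp [sigmaPow]]
  simp only [Nat.cast_zero, mul_zero, sub_zero, add_zero]
  exact sum_congr rfl fun a _ => by ring
end

section
/- For every integer n ≥ 1, the number r_4(n) of representations of n as a sum of four squares of integers satisfies, as an identity in ℂ: r_4(n) = 6·Σ_{(m,ℓ): mℓ=n} m − 2·Σ_{(m,ℓ): mℓ=n} i^m·m − 2·Σ_{(m,ℓ): mℓ=n} (−1)^m·m − 2·Σ_{(m,ℓ): mℓ=n} i^{3m}·m, where each sum runs over ordered pairs of positive integers (m, ℓ) with mℓ = n. -/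
open Finset

/-- `r_4(n)`: the number of representations of `n` as a sum of four squares of integers. -/
noncomputable def r4 (n : ℕ) : ℕ :=
  Set.ncard {x : ℤ × ℤ × ℤ × ℤ | x.1 ^ 2 + x.2.1 ^ 2 + x.2.2.1 ^ 2 + x.2.2.2 ^ 2 = (n : ℤ)}

/-- The triples `(i, d, e)` with `i ^ 2 + d * e = n` and `d, e > 0`. -/
noncomputable def liouvilleTriples (n : ℕ) : Finset (ℤ × ℤ × ℤ) :=
  (Icc (-n : ℤ) n ×ˢ Icc (1 : ℤ) n ×ˢ Icc (1 : ℤ) n).filter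
    fun t => t.1 ^ 2 + t.2.1 * t.2.2 = n

theorem mem_Icc_of_sq_le {n : ℕ} {i : ℤ} (h : i ^ 2 ≤ n) : i ∈ Icc (-n : ℤ) n := by
  rw [mem_Icc]
  constructor <;> nlinarith [sq_nonneg (i + 1), sq_nonneg (i - 1)]

theorem mem_liouvilleTriples {n : ℕ} {t : ℤ × ℤ × ℤ} :
    t ∈ liouvilleTriples n ↔ 0 < t.2.1 ∧ 0 < t.2.2 ∧ t.1 ^ 2 + t.2.1 * t.2.2 = n := by
  obtain ⟨i, d, e⟩ := t
  simp only [liouvilleTriples, mem_filter, mem_product]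
  constructor
  · rintro ⟨⟨-, hd, he⟩, h⟩
    rw [mem_Icc] at hd he
    exact ⟨by omega, by omega, h⟩
  · rintro ⟨hd, he, h⟩
    refine ⟨⟨mem_Icc_of_sq_le (by nlinarith [mul_pos hd he]), ?_, ?_⟩, h⟩ <;> rw [mem_Icc] <;>
      constructor <;> nlinarith [sq_nonneg i]

/-- The sign `(-1) ^ (i + d + e)`. -/
def tripleSign (t : ℤ × ℤ × ℤ) : ℤ := Int.negOnePow (t.1 + t.2.1 + t.2.2)

theorem tripleSign_eq_of_even {s t : ℤ × ℤ × ℤ}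
    (h : Even ((s.1 + s.2.1 + s.2.2) - (t.1 + t.2.1 + t.2.2))) :
    tripleSign s = tripleSign t := by
  rw [tripleSign, tripleSign, (Int.negOnePow_eq_iff _ _).2 h]

/-- If `Q` is the binary form with `Q(1, 0) = d`, `Q(0, 1) = -e`, `Q(1, 1) = d + 2 * i - e`, this is
the Vandermonde product of these three values. -/
def tripleVandermonde (t : ℤ × ℤ × ℤ) : ℤ :=
  (t.2.1 + t.2.2) * (t.2.1 + 2 * t.1) * (t.2.2 - 2 * t.1)

theorem sum_eq_zero_of_neg_involution {α : Type*} (s : Finset α) (f : α → ℤ) (g : α → α)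
    (hg : ∀ a ∈ s, g a ∈ s) (hgg : ∀ a ∈ s, g (g a) = a) (hf : ∀ a ∈ s, f (g a) = -f a) :
    ∑ a ∈ s, f a = 0 := by
  have h : ∑ a ∈ s, f a = ∑ a ∈ s, -f a :=
    sum_nbij' g g hg hg hgg hgg fun a ha => by rw [hf a ha, neg_neg]
  rw [sum_neg_distrib] at h
  omega

theorem sum_vandermonde_of_lt (n : ℕ) :
    ∑ t ∈ liouvilleTriples n with t.2.1 + 2 * t.1 < t.2.2,
      tripleSign t * tripleVandermonde t = 0 := by
  refine sum_eq_zero_of_neg_involution _ _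
    (fun t => (-t.1 - t.2.1, t.2.1, t.2.2 - 2 * t.1 - t.2.1)) ?_ ?_ ?_
  · rintro ⟨i, d, e⟩ h
    simp only [mem_filter, mem_liouvilleTriples] at h ⊢
    refine ⟨⟨by omega, by omega, ?_⟩, by omega⟩
    rw [← h.1.2.2]; ring
  · rintro ⟨i, d, e⟩ -
    simp only [Prod.mk.injEq]
    refine ⟨by ring, trivial, by ring⟩
  · rintro ⟨i, d, e⟩ -
    rw [tripleSign_eq_of_even (t := (i, d, e)) ⟨-2 * i - d, by ring⟩]
    simp only [tripleVandermonde]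
    ring

theorem sum_vandermonde_of_gt (n : ℕ) :
    ∑ t ∈ liouvilleTriples n with t.2.2 < t.2.1 + 2 * t.1,
      tripleSign t * tripleVandermonde t = 0 := by
  refine sum_eq_zero_of_neg_involution _ _
    (fun t => (t.2.2 - t.1, t.2.1 + 2 * t.1 - t.2.2, t.2.2)) ?_ ?_ ?_
  · rintro ⟨i, d, e⟩ h
    simp only [mem_filter, mem_liouvilleTriples] at h ⊢
    refine ⟨⟨by omega, by omega, ?_⟩, by omega⟩
    rw [← h.1.2.2]; ring
  · rintro ⟨i, d, e⟩ -
    simp only [Prod.mk.injEq]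
    refine ⟨by ring, by ring, trivial⟩
  · rintro ⟨i, d, e⟩ -
    rw [tripleSign_eq_of_even (t := (i, d, e)) ⟨0, by ring⟩]
    simp only [tripleVandermonde]
    ring

theorem sum_vandermonde_eq_boundary (n : ℕ) :
    ∑ t ∈ liouvilleTriples n, tripleSign t * tripleVandermonde t =
      ∑ t ∈ liouvilleTriples n with t.2.1 + 2 * t.1 = t.2.2,
        tripleSign t * tripleVandermonde t := by
  rw [← sum_filter_add_sum_filter_not _ (fun t => t.2.1 + 2 * t.1 < t.2.2),
    sum_vandermonde_of_lt, zero_add,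
    ← sum_filter_add_sum_filter_not _ (fun t => t.2.2 < t.2.1 + 2 * t.1),
    filter_filter, filter_filter]
  have h := sum_vandermonde_of_gt n
  rw [filter_congr (q := fun t => t.2.2 < t.2.1 + 2 * t.1) (fun t _ => by omega), h, zero_add,
    filter_congr (q := fun t => t.2.1 + 2 * t.1 = t.2.2) (fun t _ => by omega)]

theorem sum_vandermonde_of_not_isSquare {n : ℕ} (hn : ¬ IsSquare n) :
    ∑ t ∈ liouvilleTriples n, tripleSign t * tripleVandermonde t = 0 := by
  rw [sum_vandermonde_eq_boundary, filter_eq_empty_iff.2, sum_empty]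
  rintro ⟨i, d, e⟩ h heq
  rw [mem_liouvilleTriples] at h
  simp only at h heq
  apply hn
  have : IsSquare (n : ℤ) := ⟨i + d, by rw [← h.2.2, ← heq]; ring⟩
  exact_mod_cast this

theorem sum_range_alternating_parabola (c : ℤ) (k : ℕ) :
    ∑ d ∈ range (2 * k), (Int.negOnePow d : ℤ) * (d * (c - d)) = k * (2 * k - 1 - c) := by
  induction k with
  | zero => simp
  | succ k ih =>
    rw [mul_add, mul_one, sum_range_succ, sum_range_succ, ih]
    push_cast
    rw [Int.negOnePow_succ, Int.negOnePow_two_mul]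
    push_cast
    ring

theorem sum_alternating_parabola (s : ℕ) :
    ∑ d ∈ Icc (1 : ℤ) (2 * s - 1), (Int.negOnePow d : ℤ) * (d * (2 * s - d)) = -s := by
  have h : ∑ d ∈ Icc (1 : ℤ) (2 * s - 1), (Int.negOnePow d : ℤ) * (d * (2 * s - d)) =
      ∑ d ∈ range (2 * s) with d ≠ 0, (Int.negOnePow d : ℤ) * (d * (2 * s - d)) := by
    refine sum_nbij' Int.toNat Nat.cast ?_ ?_ ?_ ?_ ?_ <;> intro d hd <;>
      simp only [mem_Icc, mem_filter, mem_range] at hd ⊢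
    · omega
    · omega
    · omega
    · rfl
    · rw [Int.toNat_of_nonneg (by omega)]
  rw [h, sum_filter_of_ne, sum_range_alternating_parabola]
  · ring
  · rintro d - hd rfl
    simp at hd

theorem sum_vandermonde_sq {s : ℕ} (hs : 0 < s) :
    ∑ t ∈ liouvilleTriples (s ^ 2), tripleSign t * tripleVandermonde t =
      -(2 * (Int.negOnePow s : ℤ) * s ^ 2) := by
  rw [sum_vandermonde_eq_boundary]
  have h : ∑ t ∈ liouvilleTriples (s ^ 2) with t.2.1 + 2 * t.1 = t.2.2,
      tripleSign t * tripleVandermonde t =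
      ∑ d ∈ Icc (1 : ℤ) (2 * s - 1),
        2 * (Int.negOnePow s : ℤ) * s * ((Int.negOnePow d : ℤ) * (d * (2 * s - d))) := by
    have key : ∀ t ∈ (liouvilleTriples (s ^ 2)).filter (fun t => t.2.1 + 2 * t.1 = t.2.2),
        0 < t.2.1 ∧ 0 < t.2.2 ∧ t.1 = s - t.2.1 ∧ t.2.2 = 2 * s - t.2.1 := by
      rintro ⟨i, d, e⟩ h
      simp only [mem_filter, mem_liouvilleTriples] at h ⊢
      obtain ⟨⟨hd, he, hq⟩, heq⟩ := h
      have : i + d = s := by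
        have h2 : (i + d) ^ 2 = (s : ℤ) ^ 2 := by push_cast at hq; rw [← hq, ← heq]; ring
        exact (sq_eq_sq₀ (by omega) (by omega)).1 h2
      omega
    refine sum_nbij' (fun t => t.2.1) (fun d => (s - d, d, 2 * s - d)) ?_ ?_ ?_ ?_ ?_
    · intro t ht
      have := key t ht
      rw [mem_Icc]; omega
    · intro d hd
      rw [mem_Icc] at hd
      simp only [mem_filter, mem_liouvilleTriples]
      refine ⟨⟨by omega, by omega, ?_⟩, by ring⟩
      push_cast; ring
    · rintro ⟨i, d, e⟩ ht
      obtain ⟨-, -, h1, h2⟩ := key _ ht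
      simp only at h1 h2
      rw [h1, h2]
    · intro d _; rfl
    · rintro ⟨i, d, e⟩ ht
      obtain ⟨-, -, h1, h2⟩ := key _ ht
      simp only at h1 h2
      subst h1 h2
      have : tripleSign ((s : ℤ) - d, d, 2 * s - d) =
          (Int.negOnePow s : ℤ) * (Int.negOnePow d : ℤ) := by
        rw [tripleSign, ← Units.val_mul, ← Int.negOnePow_add]
        congr 1
        rw [Int.negOnePow_eq_iff]
        exact ⟨s - d, by ring⟩
      rw [this]
      simp only [tripleVandermonde]
      ring
  rw [h, ← mul_sum, sum_alternating_parabola]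
  ring

/-- Reflecting `i` shows that the terms of `tripleVandermonde` odd in `i` do not contribute. -/
theorem sum_vandermonde_eq (n : ℕ) :
    ∑ t ∈ liouvilleTriples n, tripleSign t * tripleVandermonde t =
      ∑ t ∈ liouvilleTriples n, tripleSign t * ((n - 5 * t.1 ^ 2) * (t.2.1 + t.2.2)) := by
  rw [← sub_eq_zero, ← sum_sub_distrib]
  refine sum_eq_zero_of_neg_involution _ _ (fun t => (-t.1, t.2)) ?_ ?_ ?_
  · intro t ht
    simpa only [mem_liouvilleTriples, neg_sq] using ht
  · intro t _
    simp
  · rintro ⟨i, d, e⟩ ht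
    rw [tripleSign_eq_of_even (t := (i, d, e)) ⟨-i, by ring⟩, ← (mem_liouvilleTriples.1 ht).2.2]
    simp only [tripleVandermonde]
    ring

/-- The signed divisor sum which equals `r4 m` for positive `m`. -/
def signedDivisorSum (m : ℕ) : ℤ :=
  -4 * ∑ p ∈ m.divisorsAntidiagonal,
    (Int.negOnePow (m + p.1 + p.2) : ℤ) * ((p.1 : ℤ) + p.2)

theorem sum_signedDivisorSum (n : ℕ) :
    ∑ i ∈ Icc (-n : ℤ) n, (n - 5 * i ^ 2) * signedDivisorSum (n - i ^ 2).toNat =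
      -4 * (Int.negOnePow n : ℤ) *
        ∑ t ∈ liouvilleTriples n, tripleSign t * ((n - 5 * t.1 ^ 2) * (t.2.1 + t.2.2)) := by
  simp only [signedDivisorSum, mul_sum]
  rw [sum_sigma']
  refine sum_bij' (fun x _ => (x.1, (x.2.1 : ℤ), (x.2.2 : ℤ)))
    (fun t _ => ⟨t.1, (t.2.1.toNat, t.2.2.toNat)⟩) ?_ ?_ ?_ ?_ ?_
  · rintro ⟨i, d, e⟩ h
    simp only [mem_sigma, Nat.mem_divisorsAntidiagonal] at h
    obtain ⟨-, h, h0⟩ := h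
    rw [mem_liouvilleTriples]
    have hd : d ≠ 0 := by rintro rfl; simp at h; omega
    have he : e ≠ 0 := by rintro rfl; simp at h; omega
    have : ((d * e : ℕ) : ℤ) = n - i ^ 2 := by omega
    push_cast at this
    refine ⟨by simp only; omega, by simp only; omega, by simp only; omega⟩
  · rintro ⟨i, d, e⟩ h
    rw [mem_liouvilleTriples] at h
    obtain ⟨hd, he, h⟩ := h
    simp only at hd he h
    have hp := mul_pos hd he
    lift d to ℕ using hd.le
    lift e to ℕ using he.le
    simp only [mem_sigma, Nat.mem_divisorsAntidiagonal, Int.toNat_natCast]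
    refine ⟨mem_Icc_of_sq_le (by omega), ?_, by omega⟩
    zify
    rw [Int.toNat_of_nonneg] <;> omega
  · rintro ⟨i, d, e⟩ h
    simp
  · rintro ⟨i, d, e⟩ h
    rw [mem_liouvilleTriples] at h
    obtain ⟨hd, he, h⟩ := h
    simp only at hd he h
    simp only [Prod.mk.injEq, true_and]
    omega
  · rintro ⟨i, d, e⟩ h
    simp only [mem_sigma, Nat.mem_divisorsAntidiagonal] at h
    have hm : (((n : ℤ) - i ^ 2).toNat : ℤ) = n - i ^ 2 := by omega
    have hs : (Int.negOnePow (((n : ℤ) - i ^ 2).toNat + d + e) : ℤ) =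
        (Int.negOnePow n : ℤ) * tripleSign (i, d, e) := by
      rw [tripleSign, ← Units.val_mul, ← Int.negOnePow_add, hm]
      congr 1
      rw [Int.negOnePow_eq_iff]
      have hi : (n - i ^ 2 + d + e - (n + (i + d + e)) : ℤ) = -(i * (i + 1)) := by ring
      simpa only [hi] using (Int.even_mul_succ_self i).neg
    rw [hs]
    ring

/-- The integers `i` with `i ^ 2 ≤ n`. -/
noncomputable def boundedRoots (n : ℕ) : Finset ℤ :=
  (Icc (-n : ℤ) n).filter fun i => i ^ 2 ≤ (n : ℤ)

theorem mem_boundedRoots {n : ℕ} {i : ℤ} : i ∈ boundedRoots n ↔ i ^ 2 ≤ n := by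
  rw [boundedRoots, mem_filter, and_iff_right_iff_imp]
  exact mem_Icc_of_sq_le

theorem signedDivisorSum_recurrence {n : ℕ} (hn : 0 < n) :
    ∑ i ∈ boundedRoots n,
      (n - 5 * i ^ 2) * (if i ^ 2 = n then 1 else signedDivisorSum (n - i ^ 2).toNat) = 0 := by
  have hzero : signedDivisorSum 0 = 0 := by simp [signedDivisorSum]
  have hsplit : ∀ i ∈ boundedRoots n,
      (n - 5 * i ^ 2) * (if i ^ 2 = n then 1 else signedDivisorSum (n - i ^ 2).toNat) =
        (n - 5 * i ^ 2) * signedDivisorSum (n - i ^ 2).toNat + if i ^ 2 = n then -4 * (n : ℤ) else 0 := by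
    intro i _
    split_ifs with h
    · simp only [h, sub_self, Int.toNat_zero, hzero]
      ring
    · ring
  rw [sum_congr rfl hsplit, sum_add_distrib, boundedRoots, sum_filter_of_ne, ← boundedRoots, sum_signedDivisorSum,
    ← sum_vandermonde_eq]
  · by_cases hsq : IsSquare n
    · obtain ⟨s, rfl⟩ := hsq
      have hs : 0 < s := Nat.pos_of_mul_pos_left hn
      rw [← sq, sum_vandermonde_sq hs, ← sum_filter, sum_const]
      have hcard : ((boundedRoots (s ^ 2)).filter fun i => i ^ 2 = ((s ^ 2 : ℕ) : ℤ)) = {(s : ℤ), -(s : ℤ)} := by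
        ext i
        simp only [mem_filter, mem_boundedRoots, mem_insert, mem_singleton]
        rw [← sq_eq_sq_iff_eq_or_eq_neg]
        push_cast
        constructor
        · exact fun h => h.2
        · exact fun h => ⟨h.le, h⟩
      rw [hcard, card_pair (by omega)]
      have hu : (Int.negOnePow (s ^ 2 : ℕ) : ℤ) * (Int.negOnePow s : ℤ) = 1 := by
        rw [← Units.val_mul, ← Int.negOnePow_add, Int.negOnePow_even, Units.val_one]
        have := Int.even_mul_succ_self s
        convert this using 1
        push_cast
        ring
      push_cast at hu ⊢
      linear_combination 8 * (s : ℤ) ^ 2 * hu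
    · rw [sum_vandermonde_of_not_isSquare hsq, sum_eq_zero, mul_zero, add_zero]
      intro i _
      rw [if_neg]
      rintro h
      refine hsq ⟨i.natAbs, ?_⟩
      zify
      rw [← h, ← sq, sq_abs]
  · intro i _ h
    by_contra hlt
    rw [Int.toNat_of_nonpos (by omega), hzero, mul_zero] at h
    exact h rfl

theorem finite_sum_four_sq_eq (n : ℕ) :
    {x : ℤ × ℤ × ℤ × ℤ | x.1 ^ 2 + x.2.1 ^ 2 + x.2.2.1 ^ 2 + x.2.2.2 ^ 2 = (n : ℤ)}.Finite := by
  refine (Icc (-n : ℤ) n ×ˢ Icc (-n : ℤ) n ×ˢ Icc (-n : ℤ) n ×ˢ Icc (-n : ℤ) n)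
    |>.finite_toSet.subset ?_
  rintro ⟨a, b, c, d⟩ h
  simp only [Set.mem_ofPred_eq] at h
  simp only [mem_coe, mem_product]
  have := sq_nonneg a
  have := sq_nonneg b
  have := sq_nonneg c
  have := sq_nonneg d
  refine ⟨?_, ?_, ?_, ?_⟩ <;> apply mem_Icc_of_sq_le <;> omega

theorem r4_recurrence (n : ℕ) :
    ∑ i ∈ boundedRoots n, (n - 5 * i ^ 2) * (r4 (n - i ^ 2).toNat : ℤ) = 0 := by
  let S : Finset (ℤ × ℤ × ℤ × ℤ × ℤ) := (boundedRoots n).sigma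
    (fun i => (finite_sum_four_sq_eq (n - i ^ 2).toNat).toFinset) |>.map
      (Equiv.sigmaEquivProd ℤ (ℤ × ℤ × ℤ × ℤ)).toEmbedding
  have hS (x) : x ∈ S ↔
      x.1 ^ 2 + x.2.1 ^ 2 + x.2.2.1 ^ 2 + x.2.2.2.1 ^ 2 + x.2.2.2.2 ^ 2 = (n : ℤ) := by
    obtain ⟨i, a, b, c, d⟩ := x
    have := sq_nonneg a
    have := sq_nonneg b
    have := sq_nonneg c
    have := sq_nonneg d
    simp only [S, mem_map_equiv, mem_sigma, mem_boundedRoots, Set.Finite.mem_toFinset,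
      Set.mem_ofPred_eq, Equiv.sigmaEquivProd_symm_apply]
    constructor
    · rintro ⟨h, h'⟩
      omega
    · intro h
      exact ⟨by omega, by omega⟩
  have hsum : ∑ i ∈ boundedRoots n, (n - 5 * i ^ 2) * (r4 (n - i ^ 2).toNat : ℤ) =
      ∑ x ∈ S, ((n : ℤ) - 5 * x.1 ^ 2) := by
    simp only [S, sum_map, sum_sigma]
    refine sum_congr rfl fun i _ => ?_
    simp only [Equiv.coe_toEmbedding, Equiv.sigmaEquivProd_apply, sum_const, r4,
      Set.ncard_eq_toFinset_card _ (finite_sum_four_sq_eq _), nsmul_eq_mul]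
    ring
  have h1 : ∑ x ∈ S, x.2.1 ^ 2 = ∑ x ∈ S, x.1 ^ 2 :=
    sum_nbij' (fun x => (x.2.1, x.1, x.2.2)) (fun x => (x.2.1, x.1, x.2.2))
      (fun x hx => by rw [hS] at hx ⊢; linarith) (fun x hx => by rw [hS] at hx ⊢; linarith)
      (fun _ _ => rfl) (fun _ _ => rfl) (fun _ _ => rfl)
  have h2 : ∑ x ∈ S, x.2.2.1 ^ 2 = ∑ x ∈ S, x.1 ^ 2 :=
    sum_nbij' (fun x => (x.2.2.1, x.2.1, x.1, x.2.2.2)) (fun x => (x.2.2.1, x.2.1, x.1, x.2.2.2))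
      (fun x hx => by rw [hS] at hx ⊢; linarith) (fun x hx => by rw [hS] at hx ⊢; linarith)
      (fun _ _ => rfl) (fun _ _ => rfl) (fun _ _ => rfl)
  have h3 : ∑ x ∈ S, x.2.2.2.1 ^ 2 = ∑ x ∈ S, x.1 ^ 2 :=
    sum_nbij' (fun x => (x.2.2.2.1, x.2.1, x.2.2.1, x.1, x.2.2.2.2))
      (fun x => (x.2.2.2.1, x.2.1, x.2.2.1, x.1, x.2.2.2.2))
      (fun x hx => by rw [hS] at hx ⊢; linarith) (fun x hx => by rw [hS] at hx ⊢; linarith)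
      (fun _ _ => rfl) (fun _ _ => rfl) (fun _ _ => rfl)
  have h4 : ∑ x ∈ S, x.2.2.2.2 ^ 2 = ∑ x ∈ S, x.1 ^ 2 :=
    sum_nbij' (fun x => (x.2.2.2.2, x.2.1, x.2.2.1, x.2.2.2.1, x.1))
      (fun x => (x.2.2.2.2, x.2.1, x.2.2.1, x.2.2.2.1, x.1))
      (fun x hx => by rw [hS] at hx ⊢; linarith) (fun x hx => by rw [hS] at hx ⊢; linarith)
      (fun _ _ => rfl) (fun _ _ => rfl) (fun _ _ => rfl)
  have h5 : ∑ x ∈ S, ((n : ℤ) - 5 * x.1 ^ 2) =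
      ∑ x ∈ S, (x.2.1 ^ 2 + x.2.2.1 ^ 2 + x.2.2.2.1 ^ 2 + x.2.2.2.2 ^ 2 - 4 * x.1 ^ 2) :=
    sum_congr rfl fun x hx => by rw [hS] at hx; linarith
  rw [hsum, h5, sum_sub_distrib, sum_add_distrib, sum_add_distrib, sum_add_distrib, h1, h2, h3, h4,
    ← mul_sum]
  ring

theorem r4_zero : r4 0 = 1 := by
  rw [r4, Set.ncard_eq_one]
  refine ⟨0, Set.eq_singleton_iff_unique_mem.2 ⟨by simp, ?_⟩⟩
  rintro ⟨a, b, c, d⟩ h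
  simp only [Set.mem_ofPred_eq, Nat.cast_zero] at h
  have ha : a ^ 2 = 0 := by nlinarith [sq_nonneg a, sq_nonneg b, sq_nonneg c, sq_nonneg d]
  have hb : b ^ 2 = 0 := by nlinarith [sq_nonneg a, sq_nonneg b, sq_nonneg c, sq_nonneg d]
  have hc : c ^ 2 = 0 := by nlinarith [sq_nonneg a, sq_nonneg b, sq_nonneg c, sq_nonneg d]
  have hd : d ^ 2 = 0 := by nlinarith [sq_nonneg a, sq_nonneg b, sq_nonneg c, sq_nonneg d]
  simp_all

theorem r4_eq_signedDivisorSum {n : ℕ} (hn : 0 < n) : (r4 n : ℤ) = signedDivisorSum n := by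
  induction n using Nat.strong_induction_on with
  | _ n ih =>
  have h := (r4_recurrence n).trans (signedDivisorSum_recurrence hn).symm
  have h0 : (0 : ℤ) ∈ boundedRoots n := by simp [mem_boundedRoots]
  rw [← add_sum_erase _ _ h0, ← add_sum_erase _ _ h0] at h
  have hrest : ∑ i ∈ (boundedRoots n).erase 0,
      (n - 5 * i ^ 2) * (r4 (n - i ^ 2).toNat : ℤ) =
      ∑ i ∈ (boundedRoots n).erase 0,
      (n - 5 * i ^ 2) * (if i ^ 2 = n then 1 else signedDivisorSum (n - i ^ 2).toNat) := by
    refine sum_congr rfl fun i hi => ?_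
    rw [mem_erase, mem_boundedRoots] at hi
    congr 1
    split_ifs with hin
    · simp [hin, r4_zero]
    · have := sq_pos_of_ne_zero hi.1
      exact ih _ (by omega) (by omega)
  rw [hrest] at h
  have hn' : (n : ℤ) ≠ 0 := by omega
  have := add_right_cancel h
  refine mul_left_cancel₀ hn' ?_
  simpa [hn'.symm] using this

theorem sum_even_even_eq_sum_four_dvd (n : ℕ) :
    ∑ p ∈ n.divisorsAntidiagonal with Even p.1 ∧ Even p.2, 2 * (p.1 : ℤ) =
      ∑ p ∈ n.divisorsAntidiagonal with 4 ∣ p.1, (p.1 : ℤ) := by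
  refine sum_nbij' (fun p => (2 * p.1, p.2 / 2)) (fun p => (p.1 / 2, 2 * p.2)) ?_ ?_ ?_ ?_ ?_
  · rintro ⟨d, e⟩ h
    simp only [mem_filter, Nat.mem_divisorsAntidiagonal, even_iff_exists_two_mul] at h ⊢
    obtain ⟨⟨h, h0⟩, ⟨a, rfl⟩, b, rfl⟩ := h
    refine ⟨⟨?_, h0⟩, ⟨a, by ring⟩⟩
    rw [Nat.mul_div_cancel_left b two_pos, ← h]; ring
  · rintro ⟨d, e⟩ h
    simp only [mem_filter, Nat.mem_divisorsAntidiagonal] at h ⊢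
    obtain ⟨⟨h, h0⟩, a, rfl⟩ := h
    have : 4 * a / 2 = 2 * a := by omega
    rw [this]
    exact ⟨⟨by rw [← h]; ring, h0⟩, even_two_mul _, even_two_mul _⟩
  · rintro ⟨d, e⟩ h
    simp only [mem_filter, even_iff_exists_two_mul] at h
    obtain ⟨-, ⟨a, rfl⟩, b, rfl⟩ := h
    simp
  · rintro ⟨d, e⟩ h
    simp only [mem_filter] at h
    obtain ⟨-, a, rfl⟩ := h
    simp only [Prod.mk.injEq]
    omega
  · rintro ⟨d, e⟩ h
    simp

theorem signedDivisorSum_eq (n : ℕ) :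
    signedDivisorSum n = 8 * ∑ p ∈ n.divisorsAntidiagonal with ¬ 4 ∣ p.1, (p.1 : ℤ) := by
  have hsign : ∀ p ∈ n.divisorsAntidiagonal,
      (Int.negOnePow (n + p.1 + p.2) : ℤ) = -1 + if Even p.1 ∧ Even p.2 then 2 else 0 := by
    rintro ⟨d, e⟩ h
    rw [Nat.mem_divisorsAntidiagonal] at h
    simp only at h ⊢
    rw [← h.1]
    split_ifs with hde
    · rw [Int.negOnePow_even]
      · rfl
      · have := hde.1
        have := hde.2
        push_cast
        simp [Int.even_add, *]
    · rw [Int.negOnePow_odd]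
      · rfl
      · rw [← Int.not_even_iff_odd]
        push_cast
        simp only [Int.even_add, Int.even_mul, Int.even_coe_nat]
        tauto
  have hswap : ∑ p ∈ n.divisorsAntidiagonal, (Int.negOnePow (n + p.1 + p.2) : ℤ) * (p.2 : ℤ) =
      ∑ p ∈ n.divisorsAntidiagonal, (Int.negOnePow (n + p.1 + p.2) : ℤ) * (p.1 : ℤ) := by
    refine sum_nbij' Prod.swap Prod.swap ?_ ?_ ?_ ?_ ?_ <;> intro p hp
    · simpa using hp
    · simpa using hp
    · simp
    · simp
    · simp [add_right_comm]
  have hodd := sum_filter_add_sum_filter_not n.divisorsAntidiagonal (fun p => 4 ∣ p.1)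
    (fun p => (p.1 : ℤ))
  rw [← sum_even_even_eq_sum_four_dvd, sum_filter] at hodd
  have hmain : ∑ p ∈ n.divisorsAntidiagonal, (Int.negOnePow (n + p.1 + p.2) : ℤ) * (p.1 : ℤ) =
      -∑ p ∈ n.divisorsAntidiagonal with ¬ 4 ∣ p.1, (p.1 : ℤ) := by
    rw [← sub_eq_iff_eq_add'.2 hodd.symm, neg_sub, ← sum_sub_distrib]
    refine sum_congr rfl fun p hp => ?_
    rw [hsign p hp]
    split_ifs <;> ring
  simp only [signedDivisorSum, mul_add, sum_add_distrib, hswap, hmain]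
  ring

theorem twisted_weight_eq (m : ℕ) :
    (6 - 2 * Complex.I ^ m - 2 * (-1) ^ m - 2 * Complex.I ^ (3 * m) : ℂ) =
      if 4 ∣ m then 0 else 8 := by
  obtain ⟨k, r, hr, rfl⟩ : ∃ k r, r < 4 ∧ m = 4 * k + r :=
    ⟨m / 4, m % 4, Nat.mod_lt _ (by norm_num), by omega⟩
  have h3 : 3 * (4 * k + r) = 4 * (3 * k) + 3 * r := by ring
  have h1 : (-1 : ℂ) ^ 4 = 1 := by norm_num
  rw [h3, pow_add, pow_add, pow_add, pow_mul, pow_mul, pow_mul, Complex.I_pow_four, h1]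
  interval_cases r <;> simp [pow_succ, Nat.dvd_add_right] <;> ring

theorem four_squares_as_twisted_divisor_sums (n : ℕ) (hn : 1 ≤ n) :
    (r4 n : ℂ)
      = 6 * ∑ p ∈ n.divisorsAntidiagonal, (p.1 : ℂ)
        - 2 * ∑ p ∈ n.divisorsAntidiagonal, Complex.I ^ p.1 * (p.1 : ℂ)
        - 2 * ∑ p ∈ n.divisorsAntidiagonal, (-1 : ℂ) ^ p.1 * (p.1 : ℂ)
        - 2 * ∑ p ∈ n.divisorsAntidiagonal, Complex.I ^ (3 * p.1) * (p.1 : ℂ) := by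
  have h : ((r4 n : ℤ) : ℂ) = _ :=
    congrArg _ ((r4_eq_signedDivisorSum hn).trans (signedDivisorSum_eq n))
  push_cast at h
  rw [h, sum_filter]
  simp only [mul_sum, ← sum_sub_distrib]
  refine sum_congr rfl fun p _ => ?_
  have hw := twisted_weight_eq p.1
  calc (8 * if ¬ 4 ∣ p.1 then (p.1 : ℂ) else 0) = (if 4 ∣ p.1 then 0 else 8) * (p.1 : ℂ) := by
        split_ifs <;> simp_all
    _ = _ := by rw [← hw]; ring
end

section
/- For every integer n ≥ 1, the number r_2(n) of representations of n as a sum of two squares of integers satisfies, as an identity in ℂ: r_2(n) = 2i·Σ_{d ∣ n} (i^{3d} − i^{d}). -/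
open Finset

/-- `r_2(n)`: the number of representations of `n` as a sum of two squares of integers. -/
noncomputable def r2 (n : ℕ) : ℕ :=
  Set.ncard {x : ℤ × ℤ | x.1 ^ 2 + x.2 ^ 2 = (n : ℤ)}

/-- A function on `ℕ` satisfying the Hecke recursion at all primes for the character `χ`. -/
def IsHeckeRecursive (χ F : ℕ → ℤ) : Prop :=
  ∀ p n : ℕ, p.Prime → 1 ≤ n →
    F (p * n) = (1 + χ p) * F n - χ p * (if p ∣ n then F (n / p) else 0)

theorem IsHeckeRecursive.ext {χ F G : ℕ → ℤ} (hF : IsHeckeRecursive χ F)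
    (hG : IsHeckeRecursive χ G) (h1 : F 1 = G 1) (n : ℕ) (hn : 1 ≤ n) : F n = G n := by
  induction n using Nat.strong_induction_on with
  | _ n ih =>
    rcases hn.eq_or_lt with rfl | hn'
    · exact h1
    obtain ⟨p, hp, m, rfl⟩ := Nat.exists_prime_and_dvd hn'.ne'
    have hm : 1 ≤ m := Nat.pos_of_ne_zero fun h => by simp [h] at hn
    have hlt : m < p * m := by nlinarith [hp.two_le]
    rw [hF p m hp hm, hG p m hp hm, ih m hlt hm]
    split_ifs with hpm
    · rw [ih (m / p) ((Nat.div_le_self m p).trans_lt hlt)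
        (Nat.div_pos (Nat.le_of_dvd hm hpm) hp.pos)]
    · rfl

theorem divisors_prime_mul {p n : ℕ} (hp : p.Prime) (hn : 1 ≤ n) :
    (p * n).divisors = n.divisors ∪ n.divisors.image (p * ·) := by
  have hp0 := hp.ne_zero
  ext d
  simp only [Nat.mem_divisors, mem_union, mem_image]
  constructor
  · rintro ⟨hd, -⟩
    by_cases hpd : p ∣ d
    · obtain ⟨e, rfl⟩ := hpd
      exact Or.inr ⟨e, ⟨Nat.dvd_of_mul_dvd_mul_left hp.pos hd, by lia⟩, rfl⟩
    · exact Or.inl ⟨((hp.coprime_iff_not_dvd.2 hpd).symm).dvd_of_dvd_mul_left hd, by lia⟩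
  · rintro (⟨hd, h0⟩ | ⟨e, ⟨he, h0⟩, rfl⟩)
    · exact ⟨hd.mul_left p, by positivity⟩
    · exact ⟨Nat.mul_dvd_mul_left p he, by positivity⟩

theorem divisors_inter_image_prime_mul {p n : ℕ} (hp : p.Prime) (hn : 1 ≤ n) :
    n.divisors ∩ n.divisors.image (p * ·) =
      if p ∣ n then (n / p).divisors.image (p * ·) else ∅ := by
  split_ifs with hpn
  · obtain ⟨m, rfl⟩ := hpn
    have hm : m ≠ 0 := by rintro rfl; simp at hn
    ext d
    simp only [Nat.mem_divisors, mem_inter, mem_image, Nat.mul_div_cancel_left m hp.pos]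
    constructor
    · rintro ⟨⟨hd, -⟩, e, -, rfl⟩
      exact ⟨e, ⟨Nat.dvd_of_mul_dvd_mul_left hp.pos hd, hm⟩, rfl⟩
    · rintro ⟨e, ⟨he, -⟩, rfl⟩
      exact ⟨⟨Nat.mul_dvd_mul_left p he, by lia⟩, e, ⟨he.mul_left p, by lia⟩, rfl⟩
  · ext d
    simp only [Nat.mem_divisors, mem_inter, mem_image, notMem_empty, iff_false]
    rintro ⟨⟨hd, -⟩, e, -, rfl⟩
    exact hpn ((dvd_mul_right p e).trans hd)

theorem isHeckeRecursive_sum_divisors (χ : ℕ →* ℤ) :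
    IsHeckeRecursive χ fun n => ∑ d ∈ n.divisors, χ d := by
  intro p n hp hn
  have himage (m : ℕ) : ∑ d ∈ m.divisors.image (p * ·), χ d = χ p * ∑ d ∈ m.divisors, χ d := by
    rw [sum_image fun a _ b _ h => Nat.eq_of_mul_eq_mul_left hp.pos h, mul_sum]
    simp
  have h := sum_union_inter (s₁ := n.divisors) (s₂ := n.divisors.image (p * ·)) (f := χ)
  rw [← divisors_prime_mul hp hn, divisors_inter_image_prime_mul hp hn, himage] at h
  split_ifs at h ⊢
  · rw [himage] at h
    linarith
  · rw [sum_empty] at h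
    linarith

/-- The Gaussian integers of norm `n`. -/
def gaussianOfNorm (n : ℕ) : Set GaussianInt := {z | z.norm = n}

theorem ncard_gaussianOfNorm (n : ℕ) : (gaussianOfNorm n).ncard = r2 n := by
  refine Set.ncard_congr (fun z _ => (z.re, z.im)) ?_ ?_ ?_
  · intro z hz
    simp only [gaussianOfNorm, Set.mem_ofPred_eq, Zsqrtd.norm_def] at hz ⊢
    linarith
  · intro z w _ _ h
    exact Zsqrtd.ext (congrArg Prod.fst h) (congrArg Prod.snd h)
  · rintro ⟨a, b⟩ h
    refine ⟨⟨a, b⟩, ?_, rfl⟩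
    simp only [gaussianOfNorm, Set.mem_ofPred_eq, Zsqrtd.norm_def] at h ⊢
    linarith

theorem finite_gaussianOfNorm (n : ℕ) : (gaussianOfNorm n).Finite := by
  refine Set.Finite.of_injOn (f := fun z : GaussianInt => (z.re, z.im))
    (t := Set.Icc (-(n : ℤ)) n ×ˢ Set.Icc (-(n : ℤ)) n) ?_ ?_
    ((Set.finite_Icc _ _).prod (Set.finite_Icc _ _))
  · intro z hz
    simp only [gaussianOfNorm, Set.mem_ofPred_eq, Zsqrtd.norm_def] at hz
    simp only [Set.mem_prod, Set.mem_Icc]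
    refine ⟨⟨?_, ?_⟩, ?_, ?_⟩ <;> nlinarith [sq_nonneg z.re, sq_nonneg z.im]
  · intro z _ w _ h
    exact Zsqrtd.ext (congrArg Prod.fst h) (congrArg Prod.snd h)

theorem mul_mem_gaussianOfNorm_iff {z : GaussianInt} {m n : ℕ} (hm : m ≠ 0) (hz : z.norm = m)
    (w : GaussianInt) : z * w ∈ gaussianOfNorm (m * n) ↔ w ∈ gaussianOfNorm n := by
  simp [gaussianOfNorm, Zsqrtd.norm_mul, hz, hm]

theorem ncard_image_mul {z : GaussianInt} (hz : z ≠ 0) (s : Set GaussianInt) :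
    ((z * ·) '' s).ncard = s.ncard :=
  Set.ncard_image_of_injective _ (mul_right_injective₀ hz)

theorem norm_natCast_gaussian (p : ℕ) : (p : GaussianInt).norm = ((p * p : ℕ) : ℤ) := by
  simp [Zsqrtd.norm_natCast]

theorem prime_dvd_of_dvd_norm {q z : GaussianInt} (hq : Prime q) (h : q ∣ (z.norm : GaussianInt)) :
    q ∣ z ∨ q ∣ star z := by
  rw [Zsqrtd.norm_eq_mul_conj] at h
  exact hq.dvd_or_dvd h

/-- Multiples of a rational prime `p` among the Gaussian integers of norm `p * n`. -/
theorem ncard_natCast_dvd {p n : ℕ} (hp : p.Prime) :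
    {z ∈ gaussianOfNorm (p * n) | (p : GaussianInt) ∣ z}.ncard =
      if p ∣ n then r2 (n / p) else 0 := by
  have hp0 : (p : GaussianInt) ≠ 0 := by exact_mod_cast hp.ne_zero
  split_ifs with hpn
  · obtain ⟨m, rfl⟩ := hpn
    rw [Nat.mul_div_cancel_left m hp.pos, ← ncard_gaussianOfNorm,
      ← ncard_image_mul hp0 (gaussianOfNorm m)]
    congr 1
    ext z
    simp only [Set.mem_ofPred_eq, Set.mem_image, ← mul_assoc]
    constructor
    · rintro ⟨hz, w, rfl⟩
      exact ⟨w, (mul_mem_gaussianOfNorm_iff (by simp [hp.ne_zero])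
        (norm_natCast_gaussian p) w).1 hz, rfl⟩
    · rintro ⟨w, hw, rfl⟩
      exact ⟨(mul_mem_gaussianOfNorm_iff (by simp [hp.ne_zero])
        (norm_natCast_gaussian p) w).2 hw, dvd_mul_right _ _⟩
  · convert Set.ncard_empty GaussianInt
    refine Set.eq_empty_of_forall_notMem ?_
    rintro z ⟨hz, w, rfl⟩
    simp only [gaussianOfNorm, Set.mem_ofPred_eq, Zsqrtd.norm_mul, norm_natCast_gaussian] at hz
    push_cast at hz
    rw [mul_assoc] at hz
    have := mul_left_cancel₀ (by exact_mod_cast hp.ne_zero) hz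
    exact hpn (by exact_mod_cast Dvd.intro _ this)

theorem r2_mul_of_mod_four_eq_three {p : ℕ} (hp : p.Prime) (h3 : p % 4 = 3) (n : ℕ) :
    r2 (p * n) = if p ∣ n then r2 (n / p) else 0 := by
  have := Fact.mk hp
  have hprime := GaussianInt.prime_of_nat_prime_of_mod_four_eq_three p h3
  rw [← ncard_natCast_dvd hp, ← ncard_gaussianOfNorm]
  congr 1
  ext z
  refine ⟨fun hz => ⟨hz, ?_⟩, fun hz => hz.1⟩
  have hd : (p : GaussianInt) ∣ (z.norm : GaussianInt) := by
    rw [show z.norm = _ from hz]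
    push_cast
    exact dvd_mul_right _ _
  rcases prime_dvd_of_dvd_norm hprime hd with h | ⟨w, hw⟩
  · exact h
  · refine ⟨star w, ?_⟩
    rw [← star_star z, hw, star_mul', star_natCast]

theorem prime_of_norm_eq_prime {p : ℕ} (hp : p.Prime) {q : GaussianInt} (hq : q.norm = p) :
    Prime q := by
  have hpz : Prime (p : ℤ) := Nat.prime_iff_prime_int.1 hp
  refine Irreducible.prime ⟨fun h => ?_, fun a b hab => ?_⟩
  · have := Zsqrtd.norm_eq_one_iff.2 h
    rw [hq, Int.natAbs_natCast] at this
    exact hp.one_lt.ne' this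
  · have h : (p : ℤ) = a.norm * b.norm := by rw [← hq, hab, Zsqrtd.norm_mul]
    refine (hpz.irreducible.isUnit_or_isUnit h).imp ?_ ?_ <;>
    exact fun h => Zsqrtd.norm_eq_one_iff.1 (Int.isUnit_iff_natAbs_eq.1 h)

theorem gaussianOfNorm_prime_mul {p : ℕ} (hp : p.Prime) {q : GaussianInt} (hq : q.norm = p)
    (n : ℕ) : gaussianOfNorm (p * n) =
      (q * ·) '' gaussianOfNorm n ∪ (star q * ·) '' gaussianOfNorm n := by
  have hq' : (star q).norm = p := by rw [Zsqrtd.norm_conj, hq]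
  ext z
  constructor
  · intro hz
    have hd : q ∣ (z.norm : GaussianInt) := by
      rw [show z.norm = _ from hz, Nat.cast_mul, ← hq, Int.cast_mul, Zsqrtd.norm_eq_mul_conj,
        mul_assoc]
      exact dvd_mul_right _ _
    rcases prime_dvd_of_dvd_norm (prime_of_norm_eq_prime hp hq) hd with ⟨w, rfl⟩ | ⟨w, hw⟩
    · exact Or.inl ⟨w, (mul_mem_gaussianOfNorm_iff hp.ne_zero hq w).1 hz, rfl⟩
    · obtain rfl : z = star q * star w := by rw [← star_star z, hw, star_mul']
      exact Or.inr ⟨star w, (mul_mem_gaussianOfNorm_iff hp.ne_zero hq' _).1 hz, rfl⟩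
  · rintro (⟨w, hw, rfl⟩ | ⟨w, hw, rfl⟩)
    · exact (mul_mem_gaussianOfNorm_iff hp.ne_zero hq w).2 hw
    · exact (mul_mem_gaussianOfNorm_iff hp.ne_zero hq' w).2 hw

theorem r2_two_mul (n : ℕ) : r2 (2 * n) = r2 n := by
  have hq : (⟨1, 1⟩ : GaussianInt).norm = (2 : ℕ) := by simp [Zsqrtd.norm_def]
  have himage : ((star ⟨1, 1⟩ : GaussianInt) * ·) '' gaussianOfNorm n ⊆
      ((⟨1, 1⟩ : GaussianInt) * ·) '' gaussianOfNorm n := by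
    rintro _ ⟨w, hw, rfl⟩
    refine ⟨⟨0, -1⟩ * w, ?_, ?_⟩
    · simpa [gaussianOfNorm, Zsqrtd.norm_mul, Zsqrtd.norm_def, add_comm] using hw
    · ext <;> simp [add_comm]
  rw [← ncard_gaussianOfNorm, gaussianOfNorm_prime_mul Nat.prime_two hq,
    Set.union_eq_self_of_subset_right himage, ncard_image_mul, ncard_gaussianOfNorm]
  intro h
  simpa using congrArg Zsqrtd.re h

theorem not_star_dvd_self {p : ℕ} (hp : p.Prime) (h2 : p ≠ 2) {q : GaussianInt}
    (hq : q.norm = p) : ¬ star q ∣ q := by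
  intro h
  have hpz : Prime (p : ℤ) := Nat.prime_iff_prime_int.1 hp
  have hsum : star q ∣ ((2 * q.re : ℤ) : GaussianInt) := by
    have : ((2 * q.re : ℤ) : GaussianInt) = q + star q := by
      ext <;> simp; ring
    rw [this]
    exact dvd_add h dvd_rfl
  obtain ⟨w, hw⟩ := hsum
  have hdvd : (p : ℤ) ∣ 2 * q.re * (2 * q.re) := by
    refine ⟨w.norm, ?_⟩
    rw [← Zsqrtd.norm_intCast, hw, Zsqrtd.norm_mul, Zsqrtd.norm_conj, hq]
  have h2' : ¬ (p : ℤ) ∣ 2 := fun h =>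
    h2 ((Nat.prime_dvd_prime_iff_eq hp Nat.prime_two).1 (by exact_mod_cast h))
  have hre : (p : ℤ) ∣ q.re := by
    rcases hpz.dvd_or_dvd hdvd with h | h <;> exact (hpz.dvd_or_dvd h).resolve_left h2'
  have hnorm : q.re * q.re + q.im * q.im = p := by
    rw [← hq, Zsqrtd.norm_def]
    ring
  have him : (p : ℤ) ∣ q.im := by
    have : (p : ℤ) ∣ q.im * q.im :=
      (dvd_add_right (hre.mul_right q.re)).1 (hnorm ▸ dvd_rfl)
    exact (hpz.dvd_or_dvd this).elim id id
  have hpp : (p : ℤ) * p ∣ p * 1 := by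
    rw [mul_one]
    nth_rw 3 [← hnorm]
    exact dvd_add (mul_dvd_mul hre hre) (mul_dvd_mul him him)
  exact hpz.not_dvd_one ((mul_dvd_mul_iff_left hpz.ne_zero).1 hpp)

theorem r2_mul_of_mod_four_eq_one {p : ℕ} (hp : p.Prime) (h1 : p % 4 = 1) (n : ℕ) :
    r2 (p * n) + (if p ∣ n then r2 (n / p) else 0) = 2 * r2 n := by
  have := Fact.mk hp
  obtain ⟨a, b, hab⟩ := Nat.Prime.sq_add_sq (p := p) (by lia)
  obtain ⟨q, hq⟩ : ∃ q : GaussianInt, q.norm = p := by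
    refine ⟨⟨a, b⟩, ?_⟩
    rw [Zsqrtd.norm_def, ← hab]
    push_cast
    ring
  have hq' : (star q).norm = p := by rw [Zsqrtd.norm_conj, hq]
  have hprime := prime_of_norm_eq_prime hp hq
  have hprime' := prime_of_norm_eq_prime hp hq'
  have hpq : (p : GaussianInt) = q * star q := by
    rw [← Zsqrtd.norm_eq_mul_conj, hq, Int.cast_natCast]
  have hinter : (q * ·) '' gaussianOfNorm n ∩ (star q * ·) '' gaussianOfNorm n =
      {z ∈ gaussianOfNorm (p * n) | (p : GaussianInt) ∣ z} := by
    ext z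
    constructor
    · rintro ⟨⟨w, hw, rfl⟩, v, -, hv⟩
      refine ⟨(mul_mem_gaussianOfNorm_iff hp.ne_zero hq w).2 hw, ?_⟩
      rw [hpq]
      exact mul_dvd_mul_left q
        ((hprime'.dvd_or_dvd (Dvd.intro v hv)).resolve_left (not_star_dvd_self hp (by lia) hq))
    · rintro ⟨hz, w, rfl⟩
      rw [hpq] at hz ⊢
      refine ⟨⟨star q * w, ?_, (mul_assoc _ _ _).symm⟩, q * w, ?_, by ring⟩
      · rwa [mul_assoc, mul_mem_gaussianOfNorm_iff hp.ne_zero hq] at hz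
      · rwa [mul_comm q, mul_assoc, mul_mem_gaussianOfNorm_iff hp.ne_zero hq'] at hz
  have h := Set.ncard_union_add_ncard_inter ((q * ·) '' gaussianOfNorm n)
    ((star q * ·) '' gaussianOfNorm n) ((finite_gaussianOfNorm n).image _)
    ((finite_gaussianOfNorm n).image _)
  rwa [← gaussianOfNorm_prime_mul hp hq, hinter, ncard_natCast_dvd hp,
    ncard_image_mul hprime.ne_zero, ncard_image_mul hprime'.ne_zero, ncard_gaussianOfNorm,
    ncard_gaussianOfNorm, ← two_mul] at h

/-- The nontrivial character modulo `4`, as a monoid homomorphism on `ℕ`. -/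
def chiFour : ℕ →* ℤ := (ZMod.χ₄ : ZMod 4 →* ℤ).comp (Nat.castRingHom (ZMod 4) : ℕ →* ZMod 4)

theorem chiFour_apply (n : ℕ) : chiFour n = ZMod.χ₄ n := rfl

theorem isHeckeRecursive_r2 : IsHeckeRecursive chiFour fun n => (r2 n : ℤ) := by
  intro p n hp _
  simp only [chiFour_apply]
  rcases hp.eq_two_or_odd with rfl | hodd
  · rw [r2_two_mul, show ZMod.χ₄ ((2 : ℕ) : ZMod 4) = 0 by decide]
    ring
  rcases Nat.odd_mod_four_iff.1 hodd with h | h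
  · rw [ZMod.χ₄_nat_one_mod_four h]
    have := r2_mul_of_mod_four_eq_one hp h n
    have : (r2 (p * n) : ℤ) + (if p ∣ n then (r2 (n / p) : ℤ) else 0) = 2 * r2 n := by
      exact_mod_cast this
    linarith
  · rw [ZMod.χ₄_nat_three_mod_four h, r2_mul_of_mod_four_eq_three hp h n]
    push_cast
    ring

theorem r2_one : r2 1 = 4 := by
  have h : {x : ℤ × ℤ | x.1 ^ 2 + x.2 ^ 2 = ((1 : ℕ) : ℤ)} =
      (({(1, 0), (-1, 0), (0, 1), (0, -1)} : Finset (ℤ × ℤ)) : Set (ℤ × ℤ)) := by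
    ext ⟨a, b⟩
    simp only [Set.mem_ofPred_eq, Nat.cast_one, coe_insert, coe_singleton, Set.mem_insert_iff,
      Set.mem_singleton_iff, Prod.mk.injEq]
    constructor
    · intro h
      have ha : -1 ≤ a ∧ a ≤ 1 := by constructor <;> nlinarith
      have hb : -1 ≤ b ∧ b ≤ 1 := by constructor <;> nlinarith
      obtain ⟨ha₁, ha₂⟩ := ha
      obtain ⟨hb₁, hb₂⟩ := hb
      interval_cases a <;> interval_cases b <;> simp at h ⊢
    · rintro (⟨rfl, rfl⟩ | ⟨rfl, rfl⟩ | ⟨rfl, rfl⟩ | ⟨rfl, rfl⟩) <;> norm_num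
  rw [r2, h, Set.ncard_coe_finset]
  rfl

/-- Jacobi's two-square theorem. -/
theorem r2_eq_four_mul_sum_chiFour (n : ℕ) (hn : 1 ≤ n) :
    (r2 n : ℤ) = 4 * ∑ d ∈ n.divisors, chiFour d := by
  refine isHeckeRecursive_r2.ext (G := fun n => 4 * ∑ d ∈ n.divisors, chiFour d) ?_ ?_ n hn
  · intro p m hp hm
    have := isHeckeRecursive_sum_divisors chiFour p m hp hm
    simp only at this ⊢
    rw [this]
    split_ifs <;> ring
  · simp [r2_one]

theorem I_pow_three_mul_sub_I_pow (d : ℕ) :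
    Complex.I ^ (3 * d) - Complex.I ^ d = -2 * Complex.I * (chiFour d : ℂ) := by
  have hI : Complex.I ^ d = Complex.I ^ (d % 4) := Complex.I_pow_eq_pow_mod d
  rw [mul_comm, pow_mul, hI, chiFour_apply, ZMod.χ₄_nat_mod_four]
  have : d % 4 < 4 := Nat.mod_lt _ (by norm_num)
  interval_cases d % 4
  · simp
  · simp [Complex.I_pow_three]
    ring
  · rw [show ZMod.χ₄ ((2 : ℕ) : ZMod 4) = 0 by decide]
    simp [Complex.I_sq]
    norm_num
  · rw [show ZMod.χ₄ ((3 : ℕ) : ZMod 4) = -1 by decide]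
    rw [Complex.I_pow_three, Odd.neg_pow (by decide), Complex.I_pow_three]
    push_cast
    ring

theorem two_squares_as_twisted_divisor_sums (n : ℕ) (hn : 1 ≤ n) :
    (r2 n : ℂ)
      = 2 * Complex.I * ∑ d ∈ n.divisors, (Complex.I ^ (3 * d) - Complex.I ^ d) := by
  have h : (r2 n : ℂ) = 4 * ∑ d ∈ n.divisors, (chiFour d : ℂ) := by
    exact_mod_cast r2_eq_four_mul_sum_chiFour n hn
  simp_rw [I_pow_three_mul_sub_I_pow]
  rw [h, ← mul_sum]
  linear_combination (4 * ∑ d ∈ n.divisors, (chiFour d : ℂ)) * Complex.I_sq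
end
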